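/- For every integer α ≥ 1: H^i_𝔪(R/I^α) = 0 for all i ∉ {1, m}, and H^1_𝔪(R/I^α) is isomorphic as an R-module to C_α, the cokernel of φ^α : R/I^α → S/𝔞^α S. -/

import Mathlib

open CategoryTheory Opposite MvPowerSeries

set_option synthInstance.maxHeartbeats 1000000
set_option maxHeartbeats 1000000

noncomputable section

/-- The grade of an ideal: the maximal length of a regular sequence contained in it. -/
def idealGrade {A : Type} [CommRing A] (J : Ideal A) : ℕ∞ :=
  sSup {c : ℕ∞ | ∃ rs : List A, (∀ r ∈ rs, r ∈ J) ∧
    RingTheory.Sequence.IsRegular A rs ∧ (rs.length : ℕ∞) = c}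

/-- The height of an ideal: the infimum of heights of primes containing it. -/
def idealHeight {A : Type} [CommRing A] (J : Ideal A) : ℕ∞ :=
  sInf {h : ℕ∞ | ∃ p : PrimeSpectrum A, J ≤ p.asIdeal ∧ Order.height p = h}

/-- A canonical module of a `d`-dimensional local ring `A`: a finitely generated module `ω`
with `Ext_A^i(𝕜, ω) = 0` for `i ≠ d` and `Ext_A^d(𝕜, ω)` a one-dimensional `𝕜`-vector space
(equivalently, isomorphic to `𝕜` as an `A`-module), where `𝕜` is the residue field. -/
def IsCanonicalModule (A : Type) [CommRing A] [IsLocalRing A] (d : ℕ)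
    (ω : ModuleCat A) : Prop :=
  Module.Finite A ω ∧
  (∀ i : ℕ, i ≠ d → Subsingleton
    (((Ext A (ModuleCat A) i).obj
      (op (ModuleCat.of A (IsLocalRing.ResidueField A)))).obj ω)) ∧
  Nonempty ((((Ext A (ModuleCat A) d).obj
      (op (ModuleCat.of A (IsLocalRing.ResidueField A)))).obj ω)
    ≃ₗ[A] IsLocalRing.ResidueField A)

variable (𝕜 : Type) [Field 𝕜] (m n : ℕ)

/-- The formal power series ring `P` in the entries of an `m × n` matrix of variables. -/
abbrev DetP := MvPowerSeries (Fin m × Fin n) 𝕜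

/-- The ideal of `P` generated by the `2 × 2` minors of the matrix of variables. -/
def detI2 : Ideal (DetP 𝕜 m n) :=
  Ideal.span {f | ∃ (i k : Fin m) (j l : Fin n), i < k ∧ j < l ∧
    f = X (i, j) * X (k, l) - X (i, l) * X (k, j)}

/-- The complete determinantal ring `R = P/I₂(X)`. -/
abbrev DetR := DetP 𝕜 m n ⧸ detI2 𝕜 m n

/-- The residue class in `R` of the variable `x_{ij}`. -/
def detx (i : Fin m) (j : Fin n) : DetR 𝕜 m n :=
  Ideal.Quotient.mk (detI2 𝕜 m n) (X (i, j))

/-- The ideal `I` of `R` generated by the entries of the first `n - 1` columns. -/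
def detJ : Ideal (DetR 𝕜 m n) :=
  Ideal.span {x | ∃ (i : Fin m) (j : Fin n), (j : ℕ) < n - 1 ∧ x = detx 𝕜 m n i j}

/-- The formal power series ring `S = 𝕜[[x_1, …, x_m, a_1, …, a_{n-1}]]`. -/
abbrev DetS := MvPowerSeries (Fin m ⊕ Fin (n - 1)) 𝕜

/-- The ideal `𝔞 = (a_1, …, a_{n-1})S`. -/
def detA : Ideal (DetS 𝕜 m n) :=
  Ideal.span {f | ∃ j : Fin (n - 1), f = X (Sum.inr j)}

/-- The property pinning down the local `𝕜`-algebra homomorphism `φ : R → S`: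
`x_{ij} ↦ a_j·x_i` for `1 ≤ j ≤ n-1` and `x_{in} ↦ x_i` (in `0`-based indexing, the last
column is `j = n-1`).  Any `𝕜`-algebra homomorphism `R → S` with these values on the
variables automatically maps the maximal ideal into the maximal ideal, hence is continuous
and is uniquely determined by these values; so this predicate characterizes `φ`. -/
def IsDetPhi (φ : DetR 𝕜 m n →ₐ[𝕜] DetS 𝕜 m n) : Prop :=
  ∀ (i : Fin m) (j : Fin n),
    φ (detx 𝕜 m n i j) =
      if h : (j : ℕ) < n - 1 then X (Sum.inr (⟨j, h⟩ : Fin (n - 1))) * X (Sum.inl i)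
      else X (Sum.inl i)

section

open CategoryTheory Limits

universe v u v' u'

namespace LeftDerivedSequence
variable {C : Type u} [Category.{v} C] [Abelian C] [HasProjectiveResolutions C]
  {D : Type u'} [Category.{v'} D] [Abelian D]
  {F G H : C ⥤ D} [F.Additive] [G.Additive] [H.Additive]
  (α : F ⟶ G) (β : G ⟶ H) (w : α ≫ β = 0)

/-- The short complex of chain complexes obtained from a short complex of additive functors. -/
def shortComplex (P : ChainComplex C ℕ) : ShortComplex (ChainComplex D ℕ) where
  X₁ := (F.mapHomologicalComplex _).obj P
  X₂ := (G.mapHomologicalComplex _).obj P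
  X₃ := (H.mapHomologicalComplex _).obj P
  f := (NatTrans.mapHomologicalComplex α _).app P
  g := (NatTrans.mapHomologicalComplex β _).app P
  zero := by
    ext i
    exact congr_app w (P.X i)

/-- Functoriality of `shortComplex` in the chain complex. -/
def shortComplexMap {P Q : ChainComplex C ℕ} (φ : P ⟶ Q) :
    shortComplex α β w P ⟶ shortComplex α β w Q where
  τ₁ := (F.mapHomologicalComplex _).map φ
  τ₂ := (G.mapHomologicalComplex _).map φ
  τ₃ := (H.mapHomologicalComplex _).map φ
  comm₁₂ := ((NatTrans.mapHomologicalComplex α _).naturality φ)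
  comm₂₃ := ((NatTrans.mapHomologicalComplex β _).naturality φ)

variable (hex : ∀ (P : C) [Projective P],
  (ShortComplex.mk (α.app P) (β.app P) (congr_app w P)).ShortExact)

omit [HasProjectiveResolutions C] in
include hex in
lemma shortExact_shortComplex {X : C} (P : ProjectiveResolution X) :
    (shortComplex α β w P.complex).ShortExact :=
  HomologicalComplex.shortExact_of_degreewise_shortExact _ fun i => hex (P.complex.X i)

variable {X Y : C} (P : ProjectiveResolution X) (Q : ProjectiveResolution Y) (n : ℕ)

/-- The left derived functor of the first functor as a homology object. -/
def iso₁ : (F.leftDerived n).obj X ≅ (shortComplex α β w P.complex).X₁.homology n :=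
  P.isoLeftDerivedObj F n

/-- The left derived functor of the second functor as a homology object. -/
def iso₂ : (G.leftDerived n).obj X ≅ (shortComplex α β w P.complex).X₂.homology n :=
  P.isoLeftDerivedObj G n

/-- The left derived functor of the third functor as a homology object. -/
def iso₃ : (H.leftDerived n).obj X ≅ (shortComplex α β w P.complex).X₃.homology n :=
  P.isoLeftDerivedObj H n

lemma map_iso₃_hom {f : X ⟶ Y} (φ : P.complex ⟶ Q.complex)
    (hφ : φ.f 0 ≫ Q.π.f 0 = P.π.f 0 ≫ f) :
    (H.leftDerived n).map f ≫ (iso₃ α β w Q n).hom =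
      (iso₃ α β w P n).hom ≫
        HomologicalComplex.homologyMap (shortComplexMap α β w φ).τ₃ n :=
  P.isoLeftDerivedObj_hom_naturality f Q φ hφ H n

lemma iso₁_inv_map {f : X ⟶ Y} (φ : P.complex ⟶ Q.complex)
    (hφ : φ.f 0 ≫ Q.π.f 0 = P.π.f 0 ≫ f) :
    (iso₁ α β w P n).inv ≫ (F.leftDerived n).map f =
      HomologicalComplex.homologyMap (shortComplexMap α β w φ).τ₁ n ≫ (iso₁ α β w Q n).inv :=
  P.isoLeftDerivedObj_inv_naturality f Q φ hφ F n

lemma app_iso₂_hom : (NatTrans.leftDerived α n).app X ≫ (iso₂ α β w P n).hom =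
    (iso₁ α β w P n).hom ≫
      HomologicalComplex.homologyMap (shortComplex α β w P.complex).f n :=
  (Iso.eq_comp_inv (P.isoLeftDerivedObj G n)).1
    ((ProjectiveResolution.leftDerived_app_eq α P n).trans (Category.assoc ..).symm)

lemma app_iso₃_hom : (NatTrans.leftDerived β n).app X ≫ (iso₃ α β w P n).hom =
    (iso₂ α β w P n).hom ≫
      HomologicalComplex.homologyMap (shortComplex α β w P.complex).g n :=
  (Iso.eq_comp_inv (P.isoLeftDerivedObj H n)).1
    ((ProjectiveResolution.leftDerived_app_eq β P n).trans (Category.assoc ..).symm)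

/-- The connecting morphism between left derived functors. -/
def δ (n : ℕ) : H.leftDerived (n + 1) ⟶ F.leftDerived n where
  app X := (iso₃ α β w (projectiveResolution X) (n + 1)).hom ≫
    (shortExact_shortComplex α β w hex (projectiveResolution X)).δ (n + 1) n (by simp) ≫
    (iso₁ α β w (projectiveResolution X) n).inv
  naturality X Y f := by
    let P := projectiveResolution X
    let Q := projectiveResolution Y
    let φ : P.complex ⟶ Q.complex := ProjectiveResolution.lift f P Q
    have hφ : φ.f 0 ≫ Q.π.f 0 = P.π.f 0 ≫ f := ProjectiveResolution.lift_commutes_zero f P Q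
    rw [reassoc_of% map_iso₃_hom α β w P Q (n + 1) φ hφ, Category.assoc, Category.assoc,
      iso₁_inv_map α β w P Q n φ hφ,
      ← reassoc_of% HomologicalComplex.HomologySequence.δ_naturality (shortComplexMap α β w φ)
      (shortExact_shortComplex α β w hex P) (shortExact_shortComplex α β w hex Q)
      (n + 1) n (by simp)]

lemma comp_δ (n : ℕ) (X : C) :
    (NatTrans.leftDerived β (n + 1)).app X ≫ (δ α β w hex n).app X = 0 := by
  have := (shortExact_shortComplex α β w hex (projectiveResolution X)).comp_δ (n + 1) n (by simp)
  rw [δ, reassoc_of% app_iso₃_hom α β w (projectiveResolution X) (n + 1), reassoc_of% this]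
  simp

lemma δ_comp (n : ℕ) (X : C) :
    (δ α β w hex n).app X ≫ (NatTrans.leftDerived α n).app X = 0 := by
  have := (shortExact_shortComplex α β w hex (projectiveResolution X)).δ_comp (n + 1) n (by simp)
  rw [← cancel_mono (iso₂ α β w (projectiveResolution X) n).hom, δ, Category.assoc,
    app_iso₂_hom]
  simp [this]

include w in
lemma comp_zero (n : ℕ) (X : C) :
    (NatTrans.leftDerived α n).app X ≫ (NatTrans.leftDerived β n).app X = 0 := by
  rw [← cancel_mono (iso₃ α β w (projectiveResolution X) n).hom, Category.assoc,
    app_iso₃_hom, reassoc_of% app_iso₂_hom, ← HomologicalComplex.homologyMap_comp,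
    ShortComplex.zero]
  simp

include hex in
lemma exact₂ (n : ℕ) (X : C) : (ShortComplex.mk ((NatTrans.leftDerived α n).app X)
    ((NatTrans.leftDerived β n).app X) (comp_zero α β w n X)).Exact := by
  let P := projectiveResolution X
  have := (shortExact_shortComplex α β w hex P).homology_exact₂ n
  refine (ShortComplex.exact_iff_of_iso ?_).2 this
  exact ShortComplex.isoMk (iso₁ α β w P n) (iso₂ α β w P n)
    (iso₃ α β w P n) (app_iso₂_hom ..).symm (app_iso₃_hom ..).symm

lemma exact₃ (n : ℕ) (X : C) : (ShortComplex.mk ((NatTrans.leftDerived β (n + 1)).app X)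
    ((δ α β w hex n).app X) (comp_δ α β w hex n X)).Exact := by
  let P := projectiveResolution X
  have := (shortExact_shortComplex α β w hex P).homology_exact₃ (n + 1) n (by simp)
  refine (ShortComplex.exact_iff_of_iso ?_).2 this
  exact ShortComplex.isoMk (iso₂ α β w P _) (iso₃ α β w P _)
    (iso₁ α β w P n) (app_iso₃_hom ..).symm (by simp [δ, P])

lemma exact₁ (n : ℕ) (X : C) : (ShortComplex.mk ((δ α β w hex n).app X)
    ((NatTrans.leftDerived α n).app X) (δ_comp α β w hex n X)).Exact := by
  let P := projectiveResolution X
  have := (shortExact_shortComplex α β w hex P).homology_exact₁ (n + 1) n (by simp)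
  refine (ShortComplex.exact_iff_of_iso ?_).2 this
  exact ShortComplex.isoMk (iso₃ α β w P _) (iso₁ α β w P n)
    (iso₂ α β w P n) (by simp [δ, P]) (app_iso₂_hom ..).symm

end LeftDerivedSequence

end

section

open CategoryTheory Limits Opposite
open scoped Pointwise

namespace localCohomology
variable {R : Type} [CommRing R]

section Ext
variable {S : ShortComplex (ModuleCat.{0} R)} (hS : S.ShortExact)

/-- The contravariant Hom functor into `M`, with values in the opposite category. -/
abbrev homTo (M : ModuleCat.{0} R) : ModuleCat.{0} R ⥤ (ModuleCat.{0} R)ᵒᵖ :=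
  ((linearYoneda R (ModuleCat.{0} R)).obj M).rightOp

/-- Functoriality of `homTo`. -/
abbrev homToMap {M N : ModuleCat.{0} R} (f : M ⟶ N) : homTo N ⟶ homTo M :=
  NatTrans.rightOp ((linearYoneda R (ModuleCat.{0} R)).map f)

lemma comp_f_comp_g (S : ShortComplex (ModuleCat.{0} R)) {X : ModuleCat.{0} R} (x : X ⟶ S.X₁) :
    (x ≫ S.f) ≫ S.g = 0 := by
  rw [Category.assoc, S.zero, comp_zero]

lemma homToMap_comp_zero (S : ShortComplex (ModuleCat.{0} R)) :
    homToMap S.g ≫ homToMap S.f = 0 := by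
  ext X
  apply Quiver.Hom.unop_inj
  ext x
  exact comp_f_comp_g S x

include hS in
lemma shortExact_homTo (P : ModuleCat.{0} R) [Projective P] :
    (ShortComplex.mk ((homToMap S.g).app P) ((homToMap S.f).app P)
      (congr_app (homToMap_comp_zero S) P)).ShortExact := by
  have := hS.mono_f
  have := hS.epi_g
  let T : ShortComplex (ModuleCat.{0} R) :=
    ShortComplex.mk (((linearYoneda R (ModuleCat.{0} R)).map S.f).app (op P))
      (((linearYoneda R (ModuleCat.{0} R)).map S.g).app (op P)) (by
        ext x
        exact comp_f_comp_g S x)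
  have hT : T.ShortExact := by
    refine { exact := ?_, mono_f := ?_, epi_g := ?_ }
    · rw [ShortComplex.ShortExact.moduleCat_exact_iff_function_exact]
      intro (x : P ⟶ S.X₂)
      constructor
      · intro (h : x ≫ S.g = 0)
        exact ⟨hS.exact.lift x h, hS.exact.lift_f x h⟩
      · rintro ⟨y, rfl⟩
        exact comp_f_comp_g S y
    · rw [ModuleCat.mono_iff_injective]
      intro (x : P ⟶ S.X₁) (y : P ⟶ S.X₁) (h : x ≫ S.f = y ≫ S.f)
      exact (cancel_mono S.f).1 h
    · rw [ModuleCat.epi_iff_surjective]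
      intro (x : P ⟶ S.X₃)
      exact ⟨Projective.factorThru x S.g, Projective.factorThru_comp x S.g⟩
  exact hT.op

/-- The connecting morphism for `Ext` in the second variable, natural in the first one. -/
def extδ (n : ℕ) : (Ext R (ModuleCat.{0} R) n).flip.obj S.X₃ ⟶
    (Ext R (ModuleCat.{0} R) (n + 1)).flip.obj S.X₁ :=
  NatTrans.leftOp (LeftDerivedSequence.δ (homToMap S.g) (homToMap S.f)
    (homToMap_comp_zero S) (shortExact_homTo hS) n)

include hS in
lemma ext_exact₂ (n : ℕ) (X : (ModuleCat.{0} R)ᵒᵖ) :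
    Function.Exact (((Ext R (ModuleCat.{0} R) n).obj X).map S.f)
      (((Ext R (ModuleCat.{0} R) n).obj X).map S.g) :=
  (ShortComplex.ShortExact.moduleCat_exact_iff_function_exact _).1
    (LeftDerivedSequence.exact₂ (homToMap S.g) (homToMap S.f)
    (homToMap_comp_zero S) (shortExact_homTo hS) n X.unop).unop

lemma ext_exact₃ (n : ℕ) (X : (ModuleCat.{0} R)ᵒᵖ) :
    Function.Exact (((Ext R (ModuleCat.{0} R) n).obj X).map S.g) ((extδ hS n).app X) :=
  (ShortComplex.ShortExact.moduleCat_exact_iff_function_exact _).1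
    (LeftDerivedSequence.exact₁ (homToMap S.g) (homToMap S.f)
    (homToMap_comp_zero S) (shortExact_homTo hS) n X.unop).unop

lemma ext_exact₁ (n : ℕ) (X : (ModuleCat.{0} R)ᵒᵖ) :
    Function.Exact ((extδ hS n).app X) (((Ext R (ModuleCat.{0} R) (n + 1)).obj X).map S.f) :=
  (ShortComplex.ShortExact.moduleCat_exact_iff_function_exact _).1
    (LeftDerivedSequence.exact₃ (homToMap S.g) (homToMap S.f)
    (homToMap_comp_zero S) (shortExact_homTo hS) n X.unop).unop

end Ext

variable (J : Ideal R)

/-- The stage `t` of the colimit defining local cohomology. -/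
abbrev stage (i : ℕ) (M : ModuleCat.{0} R) (t : ℕᵒᵖᵒᵖ) : ModuleCat.{0} R :=
  ((diagram (idealPowersDiagram J) i).obj t).obj M

/-- The transition maps between stages. -/
abbrev transition (i : ℕ) (M : ModuleCat.{0} R) {t s : ℕᵒᵖᵒᵖ} (a : t ⟶ s) :
    stage J i M t ⟶ stage J i M s :=
  ((diagram (idealPowersDiagram J) i).map a).app M

/-- Functoriality of a stage in the module. -/
abbrev stageMap (i : ℕ) {M N : ModuleCat.{0} R} (f : M ⟶ N) (t : ℕᵒᵖᵒᵖ) :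
    stage J i M t ⟶ stage J i N t :=
  ((diagram (idealPowersDiagram J) i).obj t).map f

lemma transition_stageMap (i : ℕ) {M N : ModuleCat.{0} R} (f : M ⟶ N) {t s : ℕᵒᵖᵒᵖ} (a : t ⟶ s) :
    transition J i M a ≫ stageMap J i f s = stageMap J i f t ≫ transition J i N a :=
  (((diagram (idealPowersDiagram J) i).map a).naturality f).symm

/-- The cocone exhibiting local cohomology of `M` as a colimit of `Ext` modules. -/
def cocone (i : ℕ) (M : ModuleCat.{0} R) :
    Cocone (diagram (idealPowersDiagram J) i ⋙ (evaluation _ _).obj M) :=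
  ((evaluation _ _).obj M).mapCocone (colimit.cocone (diagram (idealPowersDiagram J) i))

/-- The cocone `localCohomology.cocone` is a colimit. -/
def isColimitCocone (i : ℕ) (M : ModuleCat.{0} R) : IsColimit (cocone J i M) :=
  isColimitOfPreserves _ (colimit.isColimit _)

/-- The map from a stage to local cohomology. -/
def ι (i : ℕ) (M : ModuleCat.{0} R) (t : ℕᵒᵖᵒᵖ) :
    stage J i M t ⟶ (localCohomology J i).obj M :=
  (cocone J i M).ι.app t

lemma ι_map (i : ℕ) {M N : ModuleCat.{0} R} (f : M ⟶ N) (t : ℕᵒᵖᵒᵖ) :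
    ι J i M t ≫ (localCohomology J i).map f = stageMap J i f t ≫ ι J i N t :=
  (((colimit.cocone (diagram (idealPowersDiagram J) i)).ι.app t).naturality f).symm

lemma exists_ι_eq (i : ℕ) (M : ModuleCat.{0} R) (x : (localCohomology J i).obj M) :
    ∃ t y, ι J i M t y = x :=
  Concrete.isColimit_exists_rep _ (isColimitCocone J i M) x

lemma ι_eq_zero_iff {i : ℕ} {M : ModuleCat.{0} R} {t : ℕᵒᵖᵒᵖ} {y : stage J i M t} :
    ι J i M t y = 0 ↔ ∃ (s : ℕᵒᵖᵒᵖ) (a : t ⟶ s), transition J i M a y = 0 := by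
  rw [← map_zero (ι J i M t).hom]
  refine (Concrete.isColimit_rep_eq_iff_exists _ (isColimitCocone J i M) y 0).trans ⟨?_, ?_⟩
  · rintro ⟨s, f, g, h⟩
    exact ⟨s, f, h.trans (map_zero (transition J i M g).hom)⟩
  · rintro ⟨s, f, h⟩
    exact ⟨s, f, f, h.trans (map_zero (transition J i M f).hom).symm⟩

lemma transition_ι (i : ℕ) (M : ModuleCat.{0} R) {s t : ℕᵒᵖᵒᵖ} (a : t ⟶ s) :
    transition J i M a ≫ ι J i M s = ι J i M t :=
  (cocone J i M).w a

lemma exact_of_stages {i j k : ℕ} {L M N : ModuleCat.{0} R}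
    {a : (localCohomology J i).obj L ⟶ (localCohomology J j).obj M}
    {b : (localCohomology J j).obj M ⟶ (localCohomology J k).obj N}
    {a' : ∀ t, stage J i L t ⟶ stage J j M t} {b' : ∀ t, stage J j M t ⟶ stage J k N t}
    (ha : ∀ t, ι J i L t ≫ a = a' t ≫ ι J j M t) (hb : ∀ t, ι J j M t ≫ b = b' t ≫ ι J k N t)
    (hb' : ∀ {t s : ℕᵒᵖᵒᵖ} (u : t ⟶ s),
      transition J j M u ≫ b' s = b' t ≫ transition J k N u)
    (h : ∀ t, Function.Exact (a' t) (b' t)) : Function.Exact a b := by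
  intro x
  constructor
  · intro hx
    obtain ⟨t, y, rfl⟩ := exists_ι_eq J j M x
    have h1 : ι J k N t (b' t y) = 0 := (ConcreteCategory.congr_hom (hb t) y).symm.trans hx
    obtain ⟨s, u, h2⟩ := (ι_eq_zero_iff J).1 h1
    obtain ⟨z, hz⟩ := (h s _).1 ((ConcreteCategory.congr_hom (hb' u) y).trans h2)
    refine ⟨ι J i L s z, ?_⟩
    refine (ConcreteCategory.congr_hom (ha s) z).trans ?_
    refine (congrArg (ι J j M s) hz).trans ?_
    exact ConcreteCategory.congr_hom (transition_ι J j M u) y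
  · rintro ⟨z, rfl⟩
    obtain ⟨t, y, rfl⟩ := exists_ι_eq J i L z
    have h1 := ConcreteCategory.congr_hom (ha t) y
    have h2 := ConcreteCategory.congr_hom (hb t) (a' t y)
    refine (congrArg b h1).trans (h2.trans ?_)
    refine (congrArg (ι J k N t) ((h t _).2 ⟨y, rfl⟩)).trans (map_zero (ι J k N t).hom)

variable {S : ShortComplex (ModuleCat.{0} R)} (hS : S.ShortExact)

/-- The connecting morphism at a stage. -/
def stageδ (i : ℕ) (t : ℕᵒᵖᵒᵖ) : stage J i S.X₃ t ⟶ stage J (i + 1) S.X₁ t :=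
  (extδ hS i).app ((ringModIdeals (idealPowersDiagram J)).op.obj t)

lemma transition_stageδ (i : ℕ) {t s : ℕᵒᵖᵒᵖ} (a : t ⟶ s) :
    transition J i S.X₃ a ≫ stageδ J hS i s = stageδ J hS i t ≫ transition J (i + 1) S.X₁ a :=
  (extδ hS i).naturality ((ringModIdeals (idealPowersDiagram J)).op.map a)

/-- The connecting morphism in local cohomology. -/
def δ (i : ℕ) : (localCohomology J i).obj S.X₃ ⟶ (localCohomology J (i + 1)).obj S.X₁ :=
  (isColimitCocone J i S.X₃).desc ⟨(localCohomology J (i + 1)).obj S.X₁,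
    { app := fun t => stageδ J hS i t ≫ ι J (i + 1) S.X₁ t
      naturality := fun t s a => by
        change transition J i S.X₃ a ≫ stageδ J hS i s ≫ ι J (i + 1) S.X₁ s =
          (stageδ J hS i t ≫ ι J (i + 1) S.X₁ t) ≫ 𝟙 ((localCohomology J (i + 1)).obj S.X₁)
        rw [Category.comp_id, ← transition_ι J (i + 1) S.X₁ a, ← Category.assoc,
          transition_stageδ, Category.assoc] }⟩

lemma ι_δ (i : ℕ) (t : ℕᵒᵖᵒᵖ) :
    ι J i S.X₃ t ≫ δ J hS i = stageδ J hS i t ≫ ι J (i + 1) S.X₁ t :=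
  (isColimitCocone J i S.X₃).fac _ t

include hS in
lemma exact₂ (i : ℕ) : Function.Exact ((localCohomology J i).map S.f)
    ((localCohomology J i).map S.g) :=
  exact_of_stages J (ι_map J i S.f) (ι_map J i S.g) (transition_stageMap J i S.g)
    fun _ => ext_exact₂ hS i _

lemma exact₃ (i : ℕ) : Function.Exact ((localCohomology J i).map S.g) (δ J hS i) :=
  exact_of_stages J (ι_map J i S.g) (ι_δ J hS i) (transition_stageδ J hS i)
    fun _ => ext_exact₃ hS i _

lemma exact₁ (i : ℕ) : Function.Exact (δ J hS i) ((localCohomology J (i + 1)).map S.f) :=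
  exact_of_stages J (ι_δ J hS i) (ι_map J (i + 1) S.f) (transition_stageMap J (i + 1) S.f)
    fun _ => ext_exact₁ hS i _

end localCohomology

namespace localCohomology
variable {R : Type} [CommRing R]

lemma leftDerived_map_eq_app {C D : Type*} [Category* C] [Category* D] [Abelian C] [Abelian D]
    [HasProjectiveResolutions C] {F : C ⥤ D} [F.Additive] (α : F ⟶ F)
    {X : C} (f : X ⟶ X) (P : ProjectiveResolution X) (g : P.complex ⟶ P.complex)
    (w : g ≫ P.π = P.π ≫ (ChainComplex.single₀ C).map f)
    (h : ∀ k, F.map (g.f k) = α.app (P.complex.X k)) (n : ℕ) :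
    (F.leftDerived n).map f = (NatTrans.leftDerived α n).app X := by
  rw [Functor.leftDerived_map_eq F n f g w, ProjectiveResolution.leftDerived_app_eq α P n]
  have : (F.mapHomologicalComplex _).map g =
      (NatTrans.mapHomologicalComplex α _).app P.complex := by
    ext k
    exact h k
  rw [Functor.comp_map, this]

lemma leftDerived_map_zero {C D : Type*} [Category* C] [Category* D] [Abelian C] [Abelian D]
    [HasProjectiveResolutions C] (F : C ⥤ D) [F.Additive] (X : C) (n : ℕ) :
    (F.leftDerived n).map (0 : X ⟶ X) = 0 := by
  rw [Functor.leftDerived_map_eq F n 0 (P := projectiveResolution X) (Q := projectiveResolution X)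
    0 (by simp), Functor.map_zero, zero_comp, comp_zero]

lemma leftDerived_map_smul (M X : ModuleCat.{0} R) (x : R) (n : ℕ) :
    ((homTo M).leftDerived n).map (x • 𝟙 X) =
      (NatTrans.leftDerived (homToMap (x • 𝟙 M)) n).app X := by
  let P := projectiveResolution X
  refine leftDerived_map_eq_app _ _ P (x • 𝟙 P.complex) ?_ (fun k => ?_) n
  · ext1
    simp only [HomologicalComplex.comp_f, ChainComplex.single₀_map_f_zero, HomologicalComplex.smul_f_apply, HomologicalComplex.id_f]
    rw [Linear.smul_comp, Category.id_comp]
    exact (Linear.comp_smul _ _ _ (P.π.f 0) x (𝟙 X)).trans (congrArg (x • ·) (Category.comp_id (P.π.f 0))) |>.symm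
  · apply Quiver.Hom.unop_inj
    ext f
    change P.complex.X k ⟶ M at f
    change (x • 𝟙 (P.complex.X k)) ≫ f = f ≫ (x • 𝟙 M)
    simp

lemma stageMap_eq_zero (J : Ideal R) (i : ℕ) (M : ModuleCat.{0} R) (t : ℕᵒᵖᵒᵖ) (x : R)
    (hx : x ∈ J ^ (unop (unop t))) : stageMap J i (x • 𝟙 M) t = 0 := by
  have h := leftDerived_map_smul M (ModuleCat.of R (R ⧸ J ^ (unop (unop t)))) x i
  have h0 : x • 𝟙 (ModuleCat.of R (R ⧸ J ^ (unop (unop t)))) = 0 := by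
    ext
    change x • (Ideal.Quotient.mk (J ^ (unop (unop t))) 1) = 0
    exact (Ideal.Quotient.eq_zero_iff_mem.2 (Ideal.mul_mem_right _ _ hx) :
      Ideal.Quotient.mk (J ^ (unop (unop t))) (x * 1) = 0)
  rw [h0, leftDerived_map_zero] at h
  exact (congrArg Quiver.Hom.unop h).symm

lemma eq_zero_of_forall_pow (J : Ideal R) (i : ℕ) (M : ModuleCat.{0} R) {x : R} (hx : x ∈ J)
    (h : Function.Injective ((localCohomology J i).map (x • 𝟙 M))) :
    Subsingleton ((localCohomology J i).obj M) := by
  have key (k : ℕ) : Function.Injective ((localCohomology J i).map (x ^ k • 𝟙 M)) := by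
    induction k with
    | zero =>
      rw [pow_zero, one_smul, CategoryTheory.Functor.map_id]
      exact fun a b h => h
    | succ k ih =>
      have : x ^ (k + 1) • 𝟙 M = (x ^ k • 𝟙 M) ≫ (x • 𝟙 M) := by
        rw [Linear.smul_comp, Linear.comp_smul, smul_smul, pow_succ, Category.comp_id]
      rw [this, Functor.map_comp]
      exact h.comp ih
  refine subsingleton_of_forall_eq 0 fun z => ?_
  obtain ⟨t, y, rfl⟩ := exists_ι_eq J i M z
  apply key (unop (unop t))
  rw [map_zero]
  refine (ConcreteCategory.congr_hom (ι_map J i (x ^ (unop (unop t)) • 𝟙 M) t) y).trans ?_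
  rw [stageMap_eq_zero J i M t _ (Ideal.pow_mem_pow hx _)]
  exact map_zero (ι J i M t).hom

end localCohomology

namespace localCohomology
variable {R : Type} [CommRing R]

instance preservesFiniteColimits_homTo (M : ModuleCat.{0} R) :
    PreservesFiniteColimits (homTo M) := by
  have h1 : PreservesLimits (((linearYoneda R (ModuleCat.{0} R)).obj M) ⋙ forget _) :=
    inferInstanceAs (PreservesLimits (yoneda.obj M))
  have h2 : PreservesLimits ((linearYoneda R (ModuleCat.{0} R)).obj M) :=
    preservesLimits_of_reflects_of_preserves _ (forget (ModuleCat.{0} R))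
  exact preservesFiniteColimits_rightOp _

/-- The `Ext` in degree zero is the module of homomorphisms. -/
def stageZeroIso (J : Ideal R) (M : ModuleCat.{0} R) (t : ℕᵒᵖᵒᵖ) :
    stage J 0 M t ≅ ((linearYoneda R (ModuleCat.{0} R)).obj M).obj
      (op (ModuleCat.of R (R ⧸ J ^ (unop (unop t))))) :=
  (asIso ((homTo M).fromLeftDerivedZero.app (ModuleCat.of R (R ⧸ J ^ (unop (unop t)))))).unop.symm

/-- Evaluation at `1` from a stage in degree zero. -/
def stageZeroEval (J : Ideal R) (M : ModuleCat.{0} R) (t : ℕᵒᵖᵒᵖ) : stage J 0 M t →ₗ[R] M where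
  toFun y := (show ModuleCat.of R (R ⧸ J ^ (unop (unop t))) ⟶ M from
    (stageZeroIso J M t).hom y).hom (Ideal.Quotient.mk _ 1)
  map_add' y z := by
    rw [map_add]
    rfl
  map_smul' r y := by
    rw [map_smul]
    rfl

lemma stageZeroEval_injective (J : Ideal R) (M : ModuleCat.{0} R) (t : ℕᵒᵖᵒᵖ) :
    Function.Injective (stageZeroEval J M t) := by
  intro y z h
  apply (ConcreteCategory.bijective_of_isIso (stageZeroIso J M t).hom).1
  refine ModuleCat.hom_ext (R := R) (M := ModuleCat.of R (R ⧸ J ^ (unop (unop t)))) (N := M) ?_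
  refine Submodule.linearMap_qext (J ^ (unop (unop t))) (LinearMap.ext_ring h)

lemma smul_stageZeroEval (J : Ideal R) (M : ModuleCat.{0} R) (t : ℕᵒᵖᵒᵖ) (y : stage J 0 M t)
    {x : R} (hx : x ∈ J ^ (unop (unop t))) : x • stageZeroEval J M t y = 0 := by
  set f := (show ModuleCat.of R (R ⧸ J ^ (unop (unop t))) ⟶ M from
    (stageZeroIso J M t).hom y).hom with hf
  change x • f (Ideal.Quotient.mk _ 1) = 0
  rw [← map_smul]
  refine (congrArg f ?_).trans (map_zero f)
  exact (Ideal.Quotient.eq_zero_iff_mem.2 (Ideal.mul_mem_right _ _ hx) :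
      Ideal.Quotient.mk (J ^ (unop (unop t))) (x * 1) = 0)

lemma exists_stageZeroEval_eq (J : Ideal R) (M : ModuleCat.{0} R) (t : ℕᵒᵖᵒᵖ) (m : M)
    (h : ∀ x ∈ J ^ (unop (unop t)), x • m = 0) : ∃ y, stageZeroEval J M t y = m := by
  let f : ModuleCat.of R (R ⧸ J ^ (unop (unop t))) ⟶ M :=
    ModuleCat.ofHom (Submodule.liftQ (J ^ (unop (unop t))) (LinearMap.toSpanSingleton R M m) h)
  obtain ⟨y, hy⟩ := (ConcreteCategory.bijective_of_isIso (stageZeroIso J M t).hom).2 f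
  refine ⟨y, ?_⟩
  have : stageZeroEval J M t y = f.hom (Ideal.Quotient.mk _ 1) :=
    congrArg (fun f : ModuleCat.of R (R ⧸ J ^ (unop (unop t))) ⟶ M =>
      f.hom (Ideal.Quotient.mk _ 1)) hy
  rw [this]
  exact one_smul R m

lemma unop_comp_symm_hom {D : Type*} [Category* D] {A B A' B' : Dᵒᵖ} (p : A ≅ B) (q : A' ≅ B')
    {u : A ⟶ A'} {v : B ⟶ B'} (h : u ≫ q.hom = p.hom ≫ v) :
    u.unop ≫ p.unop.symm.hom = q.unop.symm.hom ≫ v.unop := by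
  apply Quiver.Hom.op_inj
  change p.inv ≫ u = v ≫ q.inv
  rw [Iso.inv_comp_eq, ← Category.assoc, ← h, Category.assoc, Iso.hom_inv_id, Category.comp_id]

lemma stageZeroEval_transition (J : Ideal R) (M : ModuleCat.{0} R) {t s : ℕᵒᵖᵒᵖ} (a : t ⟶ s)
    (y : stage J 0 M t) :
    stageZeroEval J M s (transition J 0 M a y) = stageZeroEval J M t y := by
  have h := (homTo M).fromLeftDerivedZero.naturality ((ringModIdeals (idealPowersDiagram J)).map a.unop)
  have h' : transition J 0 M a ≫ (stageZeroIso J M s).hom = (stageZeroIso J M t).hom ≫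
      ((homTo M).map ((ringModIdeals (idealPowersDiagram J)).map a.unop)).unop :=
    unop_comp_symm_hom
      (asIso ((homTo M).fromLeftDerivedZero.app (ModuleCat.of R (R ⧸ J ^ (unop (unop s))))))
      (asIso ((homTo M).fromLeftDerivedZero.app (ModuleCat.of R (R ⧸ J ^ (unop (unop t)))))) h
  exact congrArg (fun f : ModuleCat.of R (R ⧸ J ^ (unop (unop s))) ⟶ M =>
      f.hom (Ideal.Quotient.mk _ 1)) (ConcreteCategory.congr_hom h' y)

/-- Local cohomology in degree zero maps to the module. -/
def zeroEval (J : Ideal R) (M : ModuleCat.{0} R) : (localCohomology J 0).obj M ⟶ M :=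
  (isColimitCocone J 0 M).desc ⟨M,
    { app := fun t => ModuleCat.ofHom (stageZeroEval J M t)
      naturality := fun t s a => by
        ext y
        exact stageZeroEval_transition J M a y }⟩

lemma zeroEval_ι (J : Ideal R) (M : ModuleCat.{0} R) (t : ℕᵒᵖᵒᵖ) (y : stage J 0 M t) :
    zeroEval J M (ι J 0 M t y) = stageZeroEval J M t y :=
  ConcreteCategory.congr_hom ((isColimitCocone J 0 M).fac _ t) y

lemma zeroEval_injective (J : Ideal R) (M : ModuleCat.{0} R) :
    Function.Injective (zeroEval J M) := by
  rw [injective_iff_map_eq_zero (zeroEval J M).hom]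
  intro z hz
  obtain ⟨t, y, rfl⟩ := exists_ι_eq J 0 M z
  have h : stageZeroEval J M t y = 0 := (zeroEval_ι J M t y).symm.trans hz
  rw [(map_eq_zero_iff _ (stageZeroEval_injective J M t)).1 h]
  exact map_zero (ι J 0 M t).hom

/-- A module is `J`-torsion if each of its elements is killed by a power of `J`. -/
def IsPowTorsion (J : Ideal R) (M : Type*) [AddCommGroup M] [Module R M] : Prop :=
  ∀ m : M, ∃ k : ℕ, ∀ x ∈ J ^ k, x • m = 0

lemma zeroEval_surjective (J : Ideal R) (M : ModuleCat.{0} R) (h : IsPowTorsion J M) :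
    Function.Surjective (zeroEval J M) := by
  intro m
  obtain ⟨k, hk⟩ := h m
  obtain ⟨y, hy⟩ := exists_stageZeroEval_eq J M (op (op k)) m hk
  exact ⟨_, (zeroEval_ι J M _ y).trans hy⟩

lemma subsingleton_zero (J : Ideal R) (M : ModuleCat.{0} R) {x : R} (hx : x ∈ J)
    (hreg : IsSMulRegular M x) : Subsingleton ((localCohomology J 0).obj M) := by
  refine subsingleton_of_forall_eq 0 fun z => ?_
  apply zeroEval_injective
  obtain ⟨t, y, rfl⟩ := exists_ι_eq J 0 M z
  refine Eq.trans ?_ (map_zero (zeroEval J M).hom).symm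
  refine (zeroEval_ι J M t y).trans ?_
  exact (hreg.pow (unop (unop t))).right_eq_zero_of_smul
    (smul_stageZeroEval J M t y (Ideal.pow_mem_pow hx _))

/-- A torsion module is its own local cohomology in degree zero. -/
def zeroEquiv (J : Ideal R) (M : ModuleCat.{0} R) (h : IsPowTorsion J M) :
    (localCohomology J 0).obj M ≃ₗ[R] M :=
  LinearEquiv.ofBijective (zeroEval J M).hom ⟨zeroEval_injective J M, zeroEval_surjective J M h⟩

end localCohomology

namespace localCohomology
variable {R : Type} [CommRing R]

instance preservesHomology_homTo (E : ModuleCat.{0} R) [Injective E] :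
    (homTo E).PreservesHomology := by
  have h1 : PreservesLimits (((linearYoneda R (ModuleCat.{0} R)).obj E) ⋙ forget _) :=
    inferInstanceAs (PreservesLimits (yoneda.obj E))
  have h2 : PreservesLimits ((linearYoneda R (ModuleCat.{0} R)).obj E) :=
    preservesLimits_of_reflects_of_preserves _ (forget (ModuleCat.{0} R))
  have h3 : ((linearYoneda R (ModuleCat.{0} R)).obj E).PreservesEpimorphisms := by
    constructor
    intro X Y f hf
    rw [ModuleCat.epi_iff_surjective]
    intro (x : unop Y ⟶ E)
    exact ⟨(Injective.factorThru x f.unop : unop X ⟶ E), Injective.comp_factorThru x f.unop⟩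
  have h4 : ((linearYoneda R (ModuleCat.{0} R)).obj E).PreservesHomology :=
    Functor.preservesHomology_of_preservesEpis_and_kernels _
  have h5 : PreservesFiniteColimits ((linearYoneda R (ModuleCat.{0} R)).obj E) :=
    Functor.preservesFiniteColimits_of_preservesHomology _
  have h6 : PreservesFiniteLimits (homTo E) := preservesFiniteLimits_rightOp _
  exact Functor.preservesHomologyOfExact _

lemma isZero_leftDerived_succ_of_preservesHomology {C D : Type*} [Category* C] [Category* D]
    [Abelian C] [Abelian D] [HasProjectiveResolutions C] (F : C ⥤ D) [F.Additive]
    [F.PreservesHomology] (X : C) (n : ℕ) : IsZero ((F.leftDerived (n + 1)).obj X) := by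
  refine IsZero.of_iso ?_ ((projectiveResolution X).isoLeftDerivedObj F (n + 1))
  erw [← HomologicalComplex.exactAt_iff_isZero_homology]
  exact (((projectiveResolution X).complex_exactAt_succ n).map F :)

lemma subsingleton_succ_of_injective (J : Ideal R) (E : ModuleCat.{0} R) [Injective E] (i : ℕ) :
    Subsingleton ((localCohomology J (i + 1)).obj E) := by
  refine subsingleton_of_forall_eq 0 fun z => ?_
  obtain ⟨t, y, rfl⟩ := exists_ι_eq J (i + 1) E z
  have h : IsZero (stage J (i + 1) E t) :=
    (isZero_leftDerived_succ_of_preservesHomology (homTo E)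
      (ModuleCat.of R (R ⧸ J ^ (unop (unop t)))) i).unop
  have := ModuleCat.subsingleton_of_isZero h
  rw [Subsingleton.elim y 0]
  exact map_zero (ι J (i + 1) E t).hom

end localCohomology

namespace localCohomology
variable {R : Type} [CommRing R]

lemma leftDerived_comp_fromLeftDerivedZero {C D : Type*} [Category* C] [Category* D] [Abelian C]
    [Abelian D] [HasProjectiveResolutions C] {F G : C ⥤ D} [F.Additive] [G.Additive] (α : F ⟶ G)
    (X : C) : (NatTrans.leftDerived α 0).app X ≫ G.fromLeftDerivedZero.app X =
      F.fromLeftDerivedZero.app X ≫ α.app X := by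
  let P := projectiveResolution X
  have h : HomologicalComplex.opcyclesMap ((NatTrans.mapHomologicalComplex α _).app P.complex) 0 ≫
      P.fromLeftDerivedZero' G = P.fromLeftDerivedZero' F ≫ α.app X := by
    simp only [← cancel_epi (HomologicalComplex.pOpcycles _ _),
      HomologicalComplex.p_opcyclesMap_assoc,
      ProjectiveResolution.pOpcycles_comp_fromLeftDerivedZero',
      ProjectiveResolution.pOpcycles_comp_fromLeftDerivedZero'_assoc]
    exact (α.naturality (P.π.f 0)).symm
  rw [ProjectiveResolution.leftDerived_app_eq α P, P.fromLeftDerivedZero_eq F,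
    P.fromLeftDerivedZero_eq G]
  simp only [Category.assoc, Iso.inv_hom_id_assoc]
  refine congrArg _ ((HomologicalComplex.homologyι_naturality_assoc _ 0 _).trans ?_)
  exact (congrArg (HomologicalComplex.homologyι _ 0 ≫ ·) h).trans (Category.assoc _ _ _).symm

variable (J : Ideal R)

lemma stageZeroEval_stageMap {M N : ModuleCat.{0} R} (f : M ⟶ N) (t : ℕᵒᵖᵒᵖ) (y : stage J 0 M t) :
    stageZeroEval J N t (stageMap J 0 f t y) = f (stageZeroEval J M t y) := by
  have h := leftDerived_comp_fromLeftDerivedZero (homToMap f)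
    (ModuleCat.of R (R ⧸ J ^ (unop (unop t))))
  have h' : stageMap J 0 f t ≫ (stageZeroIso J N t).hom = (stageZeroIso J M t).hom ≫
      ((homToMap f).app (ModuleCat.of R (R ⧸ J ^ (unop (unop t))))).unop :=
    unop_comp_symm_hom
      (asIso ((homTo N).fromLeftDerivedZero.app (ModuleCat.of R (R ⧸ J ^ (unop (unop t))))))
      (asIso ((homTo M).fromLeftDerivedZero.app (ModuleCat.of R (R ⧸ J ^ (unop (unop t)))))) h
  exact congrArg (fun f : ModuleCat.of R (R ⧸ J ^ (unop (unop t))) ⟶ N =>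
      f.hom (Ideal.Quotient.mk _ 1)) (ConcreteCategory.congr_hom h' y)

lemma zeroEval_map {M N : ModuleCat.{0} R} (f : M ⟶ N) (z : (localCohomology J 0).obj M) :
    zeroEval J N ((localCohomology J 0).map f z) = f (zeroEval J M z) := by
  obtain ⟨t, y, rfl⟩ := exists_ι_eq J 0 M z
  have h := ConcreteCategory.congr_hom (ι_map J 0 f t) y
  refine (congrArg (zeroEval J N) h).trans ((zeroEval_ι J N t _).trans ?_)
  exact (stageZeroEval_stageMap J f t y).trans (congrArg f (zeroEval_ι J M t y).symm)

/-- The submodule of elements killed by a power of `J`. -/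
def powTorsion (M : Type*) [AddCommGroup M] [Module R M] : Submodule R M where
  carrier := {m | ∃ k : ℕ, ∀ x ∈ J ^ k, x • m = 0}
  zero_mem' := ⟨0, fun x _ => smul_zero x⟩
  add_mem' := by
    rintro a b ⟨k, hk⟩ ⟨l, hl⟩
    refine ⟨max k l, fun x hx => ?_⟩
    rw [smul_add, hk x (Ideal.pow_le_pow_right (le_max_left k l) hx),
      hl x (Ideal.pow_le_pow_right (le_max_right k l) hx), add_zero]
  smul_mem' := by
    rintro r a ⟨k, hk⟩
    exact ⟨k, fun x hx => by rw [smul_comm, hk x hx, smul_zero]⟩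

lemma isPowTorsion_powTorsion (M : Type*) [AddCommGroup M] [Module R M] :
    IsPowTorsion J (powTorsion J M) := by
  rintro ⟨m, k, hk⟩
  exact ⟨k, fun x hx => Subtype.ext (hk x hx)⟩

lemma exists_forall_pow_smul_eq_zero {M N : Type*} [AddCommGroup M] [Module R M]
    [AddCommGroup N] [Module R N] [IsNoetherian R N] (h : IsPowTorsion J M) (f : N →ₗ[R] M) :
    ∃ k : ℕ, ∀ x ∈ J ^ k, ∀ a, x • f a = 0 := by
  let g : ℕ →o Submodule R N :=
    { toFun := fun k =>
        { carrier := {a | ∀ x ∈ J ^ k, x • f a = 0}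
          zero_mem' := fun x _ => by simp
          add_mem' := fun {a b} ha hb x hx => by rw [map_add, smul_add, ha x hx, hb x hx, add_zero]
          smul_mem' := fun r a ha x hx => by rw [map_smul, smul_comm, ha x hx, smul_zero] }
      monotone' := fun k l hkl a ha x hx => ha x (Ideal.pow_le_pow_right hkl hx) }
  obtain ⟨n, hn⟩ := monotone_stabilizes_iff_noetherian.2 ‹_› g
  refine ⟨n, fun x hx a => ?_⟩
  obtain ⟨k, hk⟩ := h (f a)
  have h1 : a ∈ g (max n k) := g.monotone (le_max_right n k) (show a ∈ g k from hk)
  rw [← hn _ (le_max_left n k)] at h1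
  exact h1 x hx

lemma injective_powTorsion [IsNoetherianRing R] (E : Type) [AddCommGroup E] [Module R E]
    [Module.Injective R E] : Module.Injective R (powTorsion J E) := by
  refine Module.Baer.injective fun I f => ?_
  obtain ⟨k, hk⟩ := exists_forall_pow_smul_eq_zero J (isPowTorsion_powTorsion J E) f
  obtain ⟨n, hn⟩ := J.exists_pow_inf_eq_pow_smul I
  have hle : ∀ x (hx : x ∈ I), x ∈ J ^ (k + n) → f ⟨x, hx⟩ = 0 := by
    have h1 : J ^ (k + n) ⊓ I ≤ J ^ k • I := by
      have := hn (k + n) (Nat.le_add_left n k)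
      rw [smul_eq_mul, Ideal.mul_top, Nat.add_sub_cancel] at this
      rw [this]
      exact Submodule.smul_mono le_rfl inf_le_right
    intro x hx hxJ
    have h2 := h1 ⟨hxJ, hx⟩
    suffices ∀ y ∈ J ^ k • I, ∃ hy : y ∈ I, f ⟨y, hy⟩ = 0 from (this x h2).2
    intro y hy
    refine Submodule.smul_induction_on hy (fun r hr z hz => ?_) ?_
    · refine ⟨I.mul_mem_left r hz, ?_⟩
      have : (⟨r • z, I.mul_mem_left r hz⟩ : I) = r • ⟨z, hz⟩ := rfl
      rw [this, map_smul, hk r hr]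
    · rintro a b ⟨ha, ha'⟩ ⟨hb, hb'⟩
      refine ⟨I.add_mem ha hb, ?_⟩
      have : (⟨a + b, I.add_mem ha hb⟩ : I) = ⟨a, ha⟩ + ⟨b, hb⟩ := rfl
      rw [this, map_add, ha', hb', add_zero]
  let p : Submodule R I := Submodule.comap I.subtype (J ^ (k + n))
  obtain ⟨h, hh⟩ := Module.Injective.out (Q := E) (p.mapQ (J ^ (k + n)) I.subtype le_rfl)
    (by
      rw [← LinearMap.ker_eq_bot, Submodule.ker_mapQ]
      exact (Submodule.mkQ_map_self p))
    ((powTorsion J E).subtype ∘ₗ p.liftQ f (fun x hx => hle x x.2 hx))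
  refine ⟨LinearMap.codRestrict _ (h ∘ₗ (J ^ (k + n)).mkQ) fun c => ⟨k + n, fun x hx => ?_⟩, ?_⟩
  · rw [← map_smul, LinearMap.comp_apply]
    have : (J ^ (k + n)).mkQ (x • c) = 0 :=
      Ideal.Quotient.eq_zero_iff_mem.2 (Ideal.mul_mem_right c _ hx)
    rw [this, map_zero]
  · intro x hx
    exact Subtype.ext (hh (p.mkQ ⟨x, hx⟩))

end localCohomology

namespace localCohomology
variable {R : Type} [CommRing R] (J : Ideal R)

/-- The short complex formed by a linear map and the projection to its cokernel. -/
abbrev coker {M N : Type} [AddCommGroup M] [Module R M] [AddCommGroup N] [Module R N]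
    (f : M →ₗ[R] N) : ShortComplex (ModuleCat.{0} R) :=
  ShortComplex.mk (ModuleCat.ofHom f) (ModuleCat.ofHom (LinearMap.range f).mkQ) (by
    ext x
    exact (Submodule.Quotient.mk_eq_zero _).2 ⟨x, rfl⟩)

lemma shortExact_coker {M N : Type} [AddCommGroup M] [Module R M] [AddCommGroup N] [Module R N]
    {f : M →ₗ[R] N} (hf : Function.Injective f) : (coker f).ShortExact where
  exact := by
    rw [ShortComplex.ShortExact.moduleCat_exact_iff_function_exact]
    exact LinearMap.exact_map_mkQ_range f
  mono_f := (ModuleCat.mono_iff_injective _).2 hf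
  epi_g := (ModuleCat.epi_iff_surjective _).2 (Submodule.mkQ_surjective _)

lemma exists_injective_isPowTorsion [IsNoetherianRing R] (N : Type) [AddCommGroup N]
    [Module R N] (hN : IsPowTorsion J N) :
    ∃ (T : ModuleCat.{0} R) (f : N →ₗ[R] T), Function.Injective f ∧ IsPowTorsion J T ∧
      Injective T := by
  let E := Injective.under (ModuleCat.of R N)
  have hE' : Injective (ModuleCat.of R E) :=
    inferInstanceAs (Injective (Injective.under (ModuleCat.of R N)))
  have hE : Module.Injective R E := Module.injective_module_of_injective_object R E
  have hT := injective_powTorsion J E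
  let f : N →ₗ[R] powTorsion J E :=
    LinearMap.codRestrict _ (Injective.ι (ModuleCat.of R N)).hom fun m => by
      obtain ⟨k, hk⟩ := hN m
      refine ⟨k, fun x hx => ?_⟩
      rw [← map_smul, hk x hx, map_zero]
  refine ⟨ModuleCat.of R (powTorsion J E), f, fun a b hab => ?_, isPowTorsion_powTorsion J E,
    Module.injective_object_of_injective_module R _⟩
  exact (ModuleCat.mono_iff_injective (Injective.ι (ModuleCat.of R N))).1 inferInstance
      (congrArg Subtype.val hab)

lemma IsPowTorsion.of_surjective {J : Ideal R} {M N : Type*} [AddCommGroup M] [Module R M]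
    [AddCommGroup N] [Module R N] (hM : IsPowTorsion J M) (f : M →ₗ[R] N)
    (hf : Function.Surjective f) : IsPowTorsion J N := by
  intro q
  obtain ⟨t, rfl⟩ := hf q
  obtain ⟨k, hk⟩ := hM t
  exact ⟨k, fun x hx => by rw [← map_smul, hk x hx, map_zero]⟩

lemma subsingleton_of_isPowTorsion [IsNoetherianRing R] (i : ℕ) (N : Type) [AddCommGroup N]
    [Module R N] (hN : IsPowTorsion J N) :
    Subsingleton ((localCohomology J (i + 1)).obj (ModuleCat.of R N)) := by
  induction i generalizing N with
  | zero =>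
    obtain ⟨T, f, hf, htor, hT⟩ := exists_injective_isPowTorsion J N hN
    have hS := shortExact_coker hf
    refine subsingleton_of_forall_eq 0 fun z => ?_
    have h0 := subsingleton_succ_of_injective J T 0
    obtain ⟨y, rfl⟩ := (exact₁ J hS 0 z).1 (Subsingleton.elim _ _)
    obtain ⟨t, ht⟩ := Submodule.mkQ_surjective _ (zeroEval J (coker f).X₃ y)
    obtain ⟨w, rfl⟩ := zeroEval_surjective J T htor t
    refine (exact₃ J hS 0 y).2 ⟨w, ?_⟩
    apply zeroEval_injective
    exact (zeroEval_map J (coker f).g w).trans ht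
  | succ i ih =>
    obtain ⟨T, f, hf, htor, hT⟩ := exists_injective_isPowTorsion J N hN
    have hS := shortExact_coker hf
    refine subsingleton_of_forall_eq 0 fun z => ?_
    have h0 := subsingleton_succ_of_injective J T (i + 1)
    obtain ⟨y, rfl⟩ := (exact₁ J hS (i + 1) z).1 (Subsingleton.elim _ _)
    have : Subsingleton ((localCohomology J (i + 1)).obj (coker f).X₃) :=
      ih _ (htor.of_surjective (LinearMap.range f).mkQ (Submodule.mkQ_surjective _))
    rw [Subsingleton.elim y 0]
    exact map_zero (δ J hS (i + 1)).hom

/-- If `x₁, …, x_d ∈ J` is weakly regular on `M` with `J`-torsion quotient `M / (x₁, …, x_d) M`,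
then the local cohomology of `M` is concentrated in degree `d`. -/
lemma subsingleton_of_isWeaklyRegular [IsNoetherianRing R] (rs : List R) (hrs : ∀ x ∈ rs, x ∈ J)
    (M : Type) [AddCommGroup M] [Module R M] (h : RingTheory.Sequence.IsWeaklyRegular M rs)
    (ht : IsPowTorsion J (M ⧸ (Ideal.ofList rs • ⊤ : Submodule R M))) (i : ℕ) (hi : i ≠ rs.length) :
    Subsingleton ((localCohomology J i).obj (ModuleCat.of R M)) := by
  induction rs generalizing M i with
  | nil =>
    obtain ⟨i, rfl⟩ := Nat.exists_eq_succ_of_ne_zero hi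
    refine subsingleton_of_isPowTorsion J i M fun m => ?_
    obtain ⟨k, hk⟩ := ht (Submodule.Quotient.mk m)
    refine ⟨k, fun x hx => ?_⟩
    have := hk x hx
    rw [← Submodule.Quotient.mk_smul, Submodule.Quotient.mk_eq_zero, Ideal.ofList_nil,
      Submodule.bot_smul] at this
    exact this
  | cons x rs ih =>
    obtain ⟨hx, hreg⟩ := (RingTheory.Sequence.isWeaklyRegular_cons_iff M x rs).1 h
    have hxJ := hrs x List.mem_cons_self
    match i with
    | 0 => exact subsingleton_zero J _ hxJ hx
    | i + 1 =>
      have ht' : IsPowTorsion J (QuotSMulTop x M ⧸ (Ideal.ofList rs • ⊤ : Submodule R (QuotSMulTop x M))) := by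
        exact ht.of_surjective (Submodule.quotOfListConsSMulTopEquivQuotSMulTopInner M x rs).toLinearMap
          (LinearEquiv.surjective _)
      have h1 := ih (fun y hy => hrs y (List.mem_cons_of_mem x hy)) (QuotSMulTop x M) hreg ht' i
        (fun h => hi (by rw [h, List.length_cons]))
      let S : ShortComplex (ModuleCat.{0} R) :=
        ShortComplex.mk (x • 𝟙 (ModuleCat.of R M))
          (ModuleCat.ofHom (x • (⊤ : Submodule R M)).mkQ) (by
            ext m
            exact (Submodule.Quotient.mk_eq_zero _).2
              (Submodule.smul_mem_pointwise_smul m x ⊤ trivial))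
      have hS : S.ShortExact :=
        { exact := by
            rw [ShortComplex.ShortExact.moduleCat_exact_iff_function_exact]
            intro m
            refine (Submodule.Quotient.mk_eq_zero _).trans ?_
            rw [Submodule.mem_smul_pointwise_iff_exists]
            exact ⟨fun ⟨n, _, hn⟩ => ⟨n, hn⟩, fun ⟨n, hn⟩ => ⟨n, trivial, hn⟩⟩
          mono_f := (ModuleCat.mono_iff_injective _).2 hx
          epi_g := (ModuleCat.epi_iff_surjective _).2 (Submodule.mkQ_surjective _) }
      refine eq_zero_of_forall_pow J (i + 1) (ModuleCat.of R M) hxJ ?_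
      rw [injective_iff_map_eq_zero
        ((localCohomology J (i + 1)).map (x • 𝟙 (ModuleCat.of R M))).hom]
      intro z hz
      obtain ⟨y, rfl⟩ := (exact₁ J hS i z).1 hz
      have : y = 0 :=
        Subsingleton.elim (α := (localCohomology J i).obj (ModuleCat.of R (QuotSMulTop x M))) y 0
      rw [this]
      exact map_zero (δ J hS i).hom

lemma of_torsion_coker {M N : Type} [AddCommGroup M] [Module R M] [AddCommGroup N] [Module R N]
    {f : M →ₗ[R] N} (hf : Function.Injective f) (hC : IsPowTorsion J (N ⧸ LinearMap.range f)) {d : ℕ}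
    [IsNoetherianRing R] (hd : 2 ≤ d)
    (hN : ∀ i ≠ d, Subsingleton ((localCohomology J i).obj (ModuleCat.of R N))) :
    (∀ i ≠ 1, i ≠ d → Subsingleton ((localCohomology J i).obj (ModuleCat.of R M))) ∧
      Nonempty ((localCohomology J 1).obj (ModuleCat.of R M) ≃ₗ[R] (N ⧸ LinearMap.range f)) := by
  have hS := shortExact_coker hf
  constructor
  · intro i h1 hd'
    refine subsingleton_of_forall_eq 0 fun z => ?_
    have := hN i hd'
    match i with
    | 0 =>
      apply zeroEval_injective
      apply hf
      refine (zeroEval_map J (coker f).f z).symm.trans ?_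
      have h0 : (localCohomology J 0).map (coker f).f z = 0 :=
        Subsingleton.elim (α := (localCohomology J 0).obj (ModuleCat.of R N)) _ _
      refine (congrArg (zeroEval J (ModuleCat.of R N)) h0).trans ?_
      refine (map_zero (zeroEval J (ModuleCat.of R N)).hom).trans ?_
      exact (congrArg f (map_zero (zeroEval J (ModuleCat.of R M)).hom)).trans (map_zero f) |>.symm
    | 1 => exact absurd rfl h1
    | i + 2 =>
      obtain ⟨y, rfl⟩ := (exact₁ J hS (i + 1) z).1 (Subsingleton.elim _ _)
      have : Subsingleton ((localCohomology J (i + 1)).obj (coker f).X₃) :=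
        subsingleton_of_isPowTorsion J i _ hC
      rw [Subsingleton.elim y 0]
      exact map_zero (δ J hS (i + 1)).hom
  · have h0 := hN 0 (by omega)
    have h1 := hN 1 (by omega)
    have hb : Function.Bijective (δ J hS 0).hom := by
      constructor
      · rw [injective_iff_map_eq_zero]
        intro z hz
        obtain ⟨y, rfl⟩ := (exact₃ J hS 0 z).1 hz
        have : y = 0 := Subsingleton.elim (α := (localCohomology J 0).obj (ModuleCat.of R N)) y 0
        rw [this]
        exact map_zero ((localCohomology J 0).map (coker f).g).hom
      · intro z
        exact (exact₁ J hS 0 z).1 (Subsingleton.elim _ _)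
    exact ⟨(LinearEquiv.ofBijective _ hb).symm.trans (zeroEquiv J _ hC)⟩

end localCohomology

end

namespace MvPowerSeries

variable {σ k : Type*} [Field k]

/-- The power series whose coefficients vanish on a lower set of exponents. -/
def vanishingIdeal (k : Type*) [Field k] (U : LowerSet (σ →₀ ℕ)) : Ideal (MvPowerSeries σ k) where
  carrier := {f | ∀ e ∈ U, coeff e f = 0}
  zero_mem' := fun _ _ => map_zero _
  add_mem' := fun {f g} hf hg e he => by rw [map_add, hf e he, hg e he, add_zero]
  smul_mem' := fun c f hf e he => by
    classical
    rw [smul_eq_mul, coeff_mul]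
    refine Finset.sum_eq_zero fun p hp => ?_
    rw [hf p.2 (U.lower ((Finset.HasAntidiagonal.mem_antidiagonal.1 hp).le.trans' le_add_self) he), mul_zero]

lemma mem_vanishingIdeal {U : LowerSet (σ →₀ ℕ)} {f : MvPowerSeries σ k} :
    f ∈ vanishingIdeal k U ↔ ∀ e ∈ U, coeff e f = 0 := Iff.rfl

lemma coeff_X_mul_eq [DecidableEq σ] (s : σ) (f : MvPowerSeries σ k) (e : σ →₀ ℕ) :
    coeff e (X s * f) = if e s = 0 then 0 else coeff (e - Finsupp.single s 1) f := by
  rw [X_def, coeff_monomial_mul, one_mul]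
  by_cases h : e s = 0
  · rw [if_pos h, if_neg]
    intro h'
    have := h' s
    simp [h] at this
  · rw [if_neg h, if_pos]
    simpa using Nat.one_le_iff_ne_zero.2 h

lemma coeff_add_single_X_mul (s : σ) (f : MvPowerSeries σ k) (e : σ →₀ ℕ) :
    coeff (e + Finsupp.single s 1) (X s * f) = coeff e f := by
  rw [X_def, add_comm, coeff_add_monomial_mul, one_mul]

lemma exists_eq_sum_X_mul (T : Finset σ) (f : MvPowerSeries σ k)
    (h : ∀ e, coeff e f ≠ 0 → ∃ s ∈ T, e s ≠ 0) :
    ∃ F : σ → MvPowerSeries σ k, f = ∑ s ∈ T, X s * F s ∧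
      ∀ s e, coeff e (F s) ≠ 0 → coeff (e + Finsupp.single s 1) f ≠ 0 := by
  classical
  induction T using Finset.induction_on generalizing f with
  | empty =>
    refine ⟨0, ?_, fun s e h => absurd (map_zero _) h⟩
    ext e
    by_contra hne
    obtain ⟨s, hs, _⟩ := h e (by simpa using hne)
    simp at hs
  | insert s T hs ih =>
    let g : MvPowerSeries σ k := fun e => coeff (e + Finsupp.single s 1) f
    have hg (e) : coeff e g = coeff (e + Finsupp.single s 1) f := rfl
    have hc (e) : coeff e (f - X s * g) = if e s = 0 then coeff e f else 0 := by
      rw [map_sub, coeff_X_mul_eq, hg]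
      split_ifs with h0
      · rw [sub_zero]
      · rw [tsub_add_cancel_of_le (by simpa using Nat.one_le_iff_ne_zero.2 h0), sub_self]
    have hc' (e) (he : coeff e (f - X s * g) ≠ 0) : e s = 0 ∧ coeff e f ≠ 0 := by
      rw [hc] at he
      split_ifs at he with h0
      · exact ⟨h0, he⟩
      · exact absurd rfl he
    obtain ⟨F, hF, hF'⟩ := ih (f - X s * g) (fun e he => by
      obtain ⟨h0, h1⟩ := hc' e he
      obtain ⟨t, ht, ht'⟩ := h e h1
      rcases Finset.mem_insert.1 ht with rfl | ht
      · exact absurd h0 ht'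
      · exact ⟨t, ht, ht'⟩)
    refine ⟨Function.update F s g, ?_, fun t e hte => ?_⟩
    · rw [Finset.sum_insert hs, Function.update_self, Finset.sum_congr rfl (fun t ht => by
        rw [Function.update_of_ne (ne_of_mem_of_not_mem ht hs)]), ← hF]
      ring
    · rcases eq_or_ne t s with rfl | hts
      · rwa [Function.update_self, hg] at hte
      · rw [Function.update_of_ne hts] at hte
        exact (hc' _ (hF' t e hte)).2

/-- The exponents whose total degree in the variables of `T` is less than `d`. -/
def degreeLT (T : Finset σ) (d : ℕ) : LowerSet (σ →₀ ℕ) where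
  carrier := {e | ∑ s ∈ T, e s < d}
  lower' := fun _ _ hab ha => (Finset.sum_le_sum fun s _ => hab s).trans_lt ha

lemma mem_degreeLT {T : Finset σ} {d : ℕ} {e : σ →₀ ℕ} : e ∈ degreeLT T d ↔ ∑ s ∈ T, e s < d :=
  Iff.rfl

lemma span_X_pow_eq (T : Finset σ) (d : ℕ) :
    Ideal.span (X '' T : Set (MvPowerSeries σ k)) ^ d = vanishingIdeal k (degreeLT T d) := by
  classical
  induction d with
  | zero =>
    rw [pow_zero, Ideal.one_eq_top, eq_comm, Ideal.eq_top_iff_one]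
    exact fun e he => absurd he (by simp [mem_degreeLT])
  | succ d ih =>
    rw [pow_succ', ih]
    apply le_antisymm
    · rw [Ideal.mul_le]
      intro r hr f hf
      induction hr using Submodule.span_induction with
      | mem r hr =>
        obtain ⟨s, hs, rfl⟩ := hr
        intro e he
        rw [coeff_X_mul_eq]
        split_ifs with h0
        · rfl
        · apply hf
          have : ∑ t ∈ T, e t = ∑ t ∈ T, (e - Finsupp.single s 1 : σ →₀ ℕ) t + 1 := by
            have h1 : ∑ t ∈ T, (Finsupp.single s 1 : σ →₀ ℕ) t = 1 := by
              rw [Finset.sum_eq_single_of_mem s hs fun t _ ht => Finsupp.single_eq_of_ne ht]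
              simp
            refine (Finset.sum_congr rfl fun t _ => ?_).trans
              (Finset.sum_add_distrib.trans (congrArg _ h1))
            rw [← Finsupp.add_apply, tsub_add_cancel_of_le
              (by simpa using Nat.one_le_iff_ne_zero.2 h0)]
          rw [mem_degreeLT] at he ⊢
          omega
      | zero => rw [zero_mul]; exact zero_mem _
      | add x y _ _ hx hy => rw [add_mul]; exact add_mem hx hy
      | smul c x _ hx => rw [smul_mul_assoc]; exact Submodule.smul_mem _ c hx
    · intro f hf
      obtain ⟨F, hF, hF'⟩ := exists_eq_sum_X_mul T f (fun e he => by
        by_contra! h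
        exact he (hf e (by rw [mem_degreeLT, Finset.sum_eq_zero h]; omega)))
      rw [hF]
      refine sum_mem fun s hs => Ideal.mul_mem_mul (Ideal.subset_span ⟨s, hs, rfl⟩) fun e he => ?_
      by_contra hne
      refine hF' s e hne (hf _ ?_)
      rw [mem_degreeLT] at he ⊢
      have : ∑ t ∈ T, (Finsupp.single s 1 : σ →₀ ℕ) t = 1 := by
        rw [Finset.sum_eq_single_of_mem s hs fun t _ ht => Finsupp.single_eq_of_ne ht]
        simp
      simp only [Finsupp.add_apply, Finset.sum_add_distrib, this]
      omega

end MvPowerSeries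

section Determinantal

variable {𝕜 m n}

/-- The exponent of the monomial of `S` to which `φ` sends the variable indexed by `p`. -/
def entryMargin (p : Fin m × Fin n) : Fin m ⊕ Fin (n - 1) →₀ ℕ :=
  Finsupp.single (Sum.inl p.1) 1 +
    if h : (p.2 : ℕ) < n - 1 then Finsupp.single (Sum.inr ⟨p.2, h⟩) 1 else 0

/-- The exponent of the monomial of `S` to which `φ` sends the monomial with exponent `E`: its
row sums and its column sums except the last. -/
def margin : (Fin m × Fin n →₀ ℕ) →+ (Fin m ⊕ Fin (n - 1) →₀ ℕ) :=
  Finsupp.liftAddHom fun p => multiplesHom _ (entryMargin p)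

lemma margin_single (p : Fin m × Fin n) (c : ℕ) :
    margin (Finsupp.single p c) = c • entryMargin p := by
  simp [margin]

/-- The degree of an exponent of `S` in the variables `x_i`. -/
def leftDegree : (Fin m ⊕ Fin (n - 1) →₀ ℕ) →+ ℕ where
  toFun e := ∑ i, e (Sum.inl i)
  map_zero' := by simp
  map_add' _ _ := by simp [Finset.sum_add_distrib]

/-- The degree of an exponent of `S` in the variables `a_j`. -/
def rightDegree : (Fin m ⊕ Fin (n - 1) →₀ ℕ) →+ ℕ where
  toFun e := ∑ j, e (Sum.inr j)
  map_zero' := by simp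
  map_add' _ _ := by simp [Finset.sum_add_distrib]

lemma leftDegree_apply (e : Fin m ⊕ Fin (n - 1) →₀ ℕ) : leftDegree e = ∑ i, e (Sum.inl i) := rfl

lemma rightDegree_apply (e : Fin m ⊕ Fin (n - 1) →₀ ℕ) : rightDegree e = ∑ j, e (Sum.inr j) := rfl

lemma leftDegree_single_inl (i : Fin m) (c : ℕ) :
    leftDegree (Finsupp.single (Sum.inl i) c : Fin m ⊕ Fin (n - 1) →₀ ℕ) = c := by
  simp [leftDegree_apply, Finsupp.single_apply]

lemma leftDegree_single_inr (j : Fin (n - 1)) (c : ℕ) :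
    leftDegree (Finsupp.single (Sum.inr j) c : Fin m ⊕ Fin (n - 1) →₀ ℕ) = 0 := by
  simp [leftDegree_apply]

lemma rightDegree_single_inl (i : Fin m) (c : ℕ) :
    rightDegree (Finsupp.single (Sum.inl i) c : Fin m ⊕ Fin (n - 1) →₀ ℕ) = 0 := by
  simp [rightDegree_apply]

lemma rightDegree_single_inr (j : Fin (n - 1)) (c : ℕ) :
    rightDegree (Finsupp.single (Sum.inr j) c : Fin m ⊕ Fin (n - 1) →₀ ℕ) = c := by
  simp [rightDegree_apply, Finsupp.single_apply]

lemma leftDegree_margin (E : Fin m × Fin n →₀ ℕ) : leftDegree (margin E) = ∑ p, E p := by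
  induction E using Finsupp.induction_linear with
  | zero => simp
  | add E F hE hF => simp [hE, hF, Finset.sum_add_distrib]
  | single p c =>
    rw [margin_single, map_nsmul, entryMargin, map_add, leftDegree_single_inl]
    split_ifs <;> simp [leftDegree_single_inr, Finsupp.single_apply]

lemma rightDegree_entryMargin (p : Fin m × Fin n) :
    rightDegree (entryMargin p) = if (p.2 : ℕ) < n - 1 then 1 else 0 := by
  rw [entryMargin, map_add, rightDegree_single_inl]
  split_ifs <;> simp [rightDegree_single_inr]

lemma margin_inl (E : Fin m × Fin n →₀ ℕ) (i : Fin m) :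
    margin E (Sum.inl i) = ∑ j, E (i, j) := by
  induction E using Finsupp.induction_linear with
  | zero => simp
  | add E F hE hF => simp [hE, hF, Finset.sum_add_distrib]
  | single p c =>
    obtain ⟨k, l⟩ := p
    rw [margin_single, entryMargin]
    rcases eq_or_ne k i with rfl | h
    · split_ifs <;> simp [Finsupp.single_apply]
    · split_ifs <;> simp [h]

lemma margin_inr (E : Fin m × Fin n →₀ ℕ) (j : Fin n) (hj : (j : ℕ) < n - 1) :
    margin E (Sum.inr ⟨j, hj⟩) = ∑ i, E (i, j) := by
  induction E using Finsupp.induction_linear with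
  | zero => simp
  | add E F hE hF => simp [hE, hF, Finset.sum_add_distrib]
  | single p c =>
    obtain ⟨k, l⟩ := p
    rw [margin_single, entryMargin]
    rcases eq_or_ne l j with rfl | h
    · simp [Finsupp.single_apply, hj]
    · split_ifs <;> simp [h, Fin.val_inj]

lemma rightDegree_margin_add (E : Fin m × Fin n →₀ ℕ) (j : Fin n) (hj : ¬ (j : ℕ) < n - 1) :
    rightDegree (margin E) + ∑ i, E (i, j) = leftDegree (margin E) := by
  rw [leftDegree_margin]
  induction E using Finsupp.induction_linear with
  | zero => simp
  | add E F hE hF => simp [← hE, ← hF, Finset.sum_add_distrib, add_add_add_comm]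
  | single p c =>
    obtain ⟨k, l⟩ := p
    rw [margin_single, map_nsmul, rightDegree_entryMargin]
    rcases eq_or_ne l j with rfl | h
    · simp [Finsupp.single_apply, hj]
    · have : (l : ℕ) < n - 1 := by
        have := Fin.val_ne_of_ne h
        omega
      simp [Finsupp.single_apply, h, this]

lemma sum_column_eq {E F : Fin m × Fin n →₀ ℕ} (h : margin E = margin F) (j : Fin n) :
    ∑ i, E (i, j) = ∑ i, F (i, j) := by
  by_cases hj : (j : ℕ) < n - 1
  · rw [← margin_inr E j hj, h, margin_inr]
  · have := rightDegree_margin_add E j hj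
    have := rightDegree_margin_add F j hj
    rw [h] at *
    omega

lemma exists_margin_eq (hn : 2 ≤ n) (e : Fin m ⊕ Fin (n - 1) →₀ ℕ)
    (he : rightDegree e ≤ leftDegree e) : ∃ E, margin E = e := by
  induction hd : leftDegree e generalizing e with
  | zero =>
    refine ⟨0, ?_⟩
    rw [map_zero, eq_comm]
    have h1 : rightDegree e = 0 := by omega
    rw [leftDegree_apply, Finset.sum_eq_zero_iff] at hd
    rw [rightDegree_apply, Finset.sum_eq_zero_iff] at h1
    ext (i | j)
    · exact hd i (Finset.mem_univ _)
    · exact h1 j (Finset.mem_univ _)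
  | succ d ih =>
    obtain ⟨i, -, hi⟩ := Finset.exists_ne_zero_of_sum_ne_zero
      (show ∑ i, e (Sum.inl i) ≠ 0 by rw [← leftDegree_apply]; omega)
    suffices ∃ p e', e' + entryMargin p = e ∧ leftDegree e' = d ∧ rightDegree e' ≤ d by
      obtain ⟨p, e', h, h1, h2⟩ := this
      obtain ⟨E, hE⟩ := ih e' (by omega) h1
      exact ⟨E + Finsupp.single p 1, by rw [map_add, hE, margin_single, one_smul, h]⟩
    suffices ∃ p : Fin m × Fin n, entryMargin p ≤ e ∧ leftDegree (entryMargin p) = 1 ∧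
        rightDegree e ≤ d + rightDegree (entryMargin p) by
      obtain ⟨p, h, h1, h2⟩ := this
      have h3 := tsub_add_cancel_of_le h
      refine ⟨p, e - entryMargin p, h3, ?_, ?_⟩
      · have := congrArg leftDegree h3
        rw [map_add] at this
        omega
      · have := congrArg rightDegree h3
        rw [map_add] at this
        omega
    have hp (p : Fin m × Fin n) : leftDegree (entryMargin p) = 1 := by
      rw [← one_smul ℕ (entryMargin p), ← margin_single, leftDegree_margin]
      simp [Finsupp.single_apply]
    by_cases hr : rightDegree e = 0
    · refine ⟨(i, ⟨n - 1, by omega⟩), ?_, hp _, by omega⟩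
      simpa [entryMargin] using Nat.one_le_iff_ne_zero.2 hi
    · obtain ⟨j, -, hj⟩ := Finset.exists_ne_zero_of_sum_ne_zero (rightDegree_apply e ▸ hr)
      have hj' : (j : ℕ) < n - 1 := j.2
      refine ⟨(i, ⟨j, by omega⟩), ?_, hp _, ?_⟩
      · intro t
        rcases t with t | t
        · rcases eq_or_ne t i with rfl | ht
          · simpa [entryMargin] using Nat.one_le_iff_ne_zero.2 hi
          · simp [entryMargin, ht.symm]
        · rcases eq_or_ne t j with rfl | ht
          · simpa [entryMargin] using Nat.one_le_iff_ne_zero.2 hj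
          · simp [entryMargin, ht.symm]
      · rw [rightDegree_entryMargin, if_pos hj']
        omega

/-- The residue class in `R` of a monomial. -/
def detMonomial (𝕜 : Type) [Field 𝕜] (E : Fin m × Fin n →₀ ℕ) : DetR 𝕜 m n :=
  Ideal.Quotient.mk (detI2 𝕜 m n) (monomial E 1)

lemma detMonomial_zero : detMonomial 𝕜 (0 : Fin m × Fin n →₀ ℕ) = 1 :=
  map_one (Ideal.Quotient.mk (detI2 𝕜 m n))

lemma detMonomial_add (E F : Fin m × Fin n →₀ ℕ) :
    detMonomial 𝕜 (E + F) = detMonomial 𝕜 E * detMonomial 𝕜 F := by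
  rw [detMonomial, detMonomial, detMonomial, ← map_mul, monomial_mul_monomial, one_mul]

lemma detMonomial_single (p : Fin m × Fin n) (c : ℕ) :
    detMonomial 𝕜 (Finsupp.single p c) = detx 𝕜 m n p.1 p.2 ^ c := by
  rw [detMonomial, detx, ← map_pow, X_pow_eq]

lemma detx_mul_detx_comm (i k : Fin m) (j l : Fin n) :
    detx 𝕜 m n i j * detx 𝕜 m n k l = detx 𝕜 m n i l * detx 𝕜 m n k j := by
  have key (i k : Fin m) (j l : Fin n) (hik : i < k) (hjl : j < l) :
      detx 𝕜 m n i j * detx 𝕜 m n k l = detx 𝕜 m n i l * detx 𝕜 m n k j := by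
    rw [detx, detx, detx, detx, ← map_mul, ← map_mul, Ideal.Quotient.eq]
    exact Ideal.subset_span ⟨i, k, j, l, hik, hjl, rfl⟩
  rcases lt_trichotomy i k with h | rfl | h <;> rcases lt_trichotomy j l with h' | rfl | h'
  · exact key i k j l h h'
  · rfl
  · exact (key i k l j h h').symm
  · exact mul_comm _ _
  · rfl
  · exact mul_comm _ _
  · rw [mul_comm, mul_comm (detx 𝕜 m n i l)]
    exact (key k i j l h h').symm
  · exact mul_comm _ _ |>.trans (mul_comm _ _)
  · rw [mul_comm, mul_comm (detx 𝕜 m n i l)]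
    exact key k i l j h h'

lemma detMonomial_congr {E F : Fin m × Fin n →₀ ℕ} (h : margin E = margin F) :
    detMonomial 𝕜 E = detMonomial 𝕜 F := by
  induction hd : leftDegree (margin E) generalizing E F with
  | zero =>
    have hz (G : Fin m × Fin n →₀ ℕ) (hG : leftDegree (margin G) = 0) : G = 0 := by
      rw [leftDegree_margin, Finset.sum_eq_zero_iff] at hG
      ext p
      exact hG p (Finset.mem_univ _)
    rw [hz E hd, hz F (h ▸ hd)]
  | succ d ih =>
    have hle {G : Fin m × Fin n →₀ ℕ} {p} (hp : G p ≠ 0) :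
        G - Finsupp.single p 1 + Finsupp.single p 1 = G :=
      tsub_add_cancel_of_le (by simpa using Nat.one_le_iff_ne_zero.2 hp)
    obtain ⟨⟨i, j⟩, -, hp⟩ := Finset.exists_ne_zero_of_sum_ne_zero
      (show ∑ p, E p ≠ 0 by rw [← leftDegree_margin]; omega)
    suffices ∃ F', margin F' = margin F ∧ detMonomial 𝕜 F' = detMonomial 𝕜 F ∧ F' (i, j) ≠ 0 by
      obtain ⟨F', h1, h2, h3⟩ := this
      rw [← h2, ← hle hp, ← hle h3, detMonomial_add, detMonomial_add, ih]
      · rw [← h1, ← hle hp, ← hle h3, map_add, map_add] at h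
        exact add_right_cancel h
      · have := leftDegree_margin (Finsupp.single (i, j) 1)
        rw [← hle hp, map_add, map_add, this] at hd
        simpa [Finsupp.single_apply] using hd
    by_cases hF : F (i, j) = 0
    swap
    · exact ⟨F, rfl, rfl, hF⟩
    obtain ⟨l, -, hl⟩ : ∃ l ∈ Finset.univ, F (i, l) ≠ 0 := by
      apply Finset.exists_ne_zero_of_sum_ne_zero
      rw [← margin_inl, ← h, margin_inl]
      exact fun h0 => hp (Finset.sum_eq_zero_iff.1 h0 j (Finset.mem_univ _))
    obtain ⟨k, -, hk⟩ : ∃ k ∈ Finset.univ, F (k, j) ≠ 0 := by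
      apply Finset.exists_ne_zero_of_sum_ne_zero
      rw [← sum_column_eq h]
      exact fun h0 => hp (Finset.sum_eq_zero_iff.1 h0 i (Finset.mem_univ _))
    have hjl : l ≠ j := by
      rintro rfl
      exact hl hF
    have hk' : (F - Finsupp.single (i, l) 1 : Fin m × Fin n →₀ ℕ) (k, j) ≠ 0 := by
      simpa [Finsupp.single_apply, hjl] using hk
    have hF' := hle hl
    rw [← hle hk'] at hF'
    refine ⟨F - Finsupp.single (i, l) 1 - Finsupp.single (k, j) 1 + Finsupp.single (i, j) 1 +
      Finsupp.single (k, l) 1, ?_, ?_, ?_⟩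
    · conv_rhs => rw [← hF']
      simp only [map_add, margin_single, entryMargin]
      abel
    · conv_rhs => rw [← hF']
      simp only [detMonomial_add, detMonomial_single, pow_one, mul_assoc]
      rw [detx_mul_detx_comm i k j l, mul_comm (detx 𝕜 m n k j)]
    · simp

lemma detMonomial_mem_pow (E : Fin m × Fin n →₀ ℕ) :
    detMonomial 𝕜 E ∈ detJ 𝕜 m n ^ rightDegree (margin E) := by
  induction E using Finsupp.induction_linear with
  | zero => simp
  | add E F hE hF =>
    rw [detMonomial_add, map_add, map_add]
    exact (pow_add (detJ 𝕜 m n) _ _).ge (Ideal.mul_mem_mul hE hF)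
  | single p c =>
    rw [detMonomial_single, margin_single, map_nsmul, rightDegree_entryMargin, smul_eq_mul,
      mul_comm]
    refine (pow_mul (detJ 𝕜 m n) _ _).ge (Ideal.pow_mem_pow ?_ c)
    split_ifs with h
    · rw [pow_one]
      exact Ideal.subset_span ⟨p.1, p.2, h, rfl⟩
    · simp

end Determinantal

section DeterminantalMap

variable {𝕜 m n}

instance : IsNoetherianRing (DetR 𝕜 m n) :=
  inferInstanceAs (IsNoetherianRing (DetP 𝕜 m n ⧸ detI2 𝕜 m n))

/-- The variables `x_i` of `S`. -/
def leftVars (m n : ℕ) : Finset (Fin m ⊕ Fin (n - 1)) :=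
  Finset.univ.map Function.Embedding.inl

/-- The variables `a_j` of `S`. -/
def rightVars (m n : ℕ) : Finset (Fin m ⊕ Fin (n - 1)) :=
  Finset.univ.map Function.Embedding.inr

lemma mem_degreeLT_leftVars {e : Fin m ⊕ Fin (n - 1) →₀ ℕ} {d : ℕ} :
    e ∈ degreeLT (leftVars m n) d ↔ leftDegree e < d := by
  rw [mem_degreeLT, leftVars, Finset.sum_map]
  rfl

lemma mem_degreeLT_rightVars {e : Fin m ⊕ Fin (n - 1) →₀ ℕ} {d : ℕ} :
    e ∈ degreeLT (rightVars m n) d ↔ rightDegree e < d := by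
  rw [mem_degreeLT, rightVars, Finset.sum_map]
  rfl

lemma detA_pow_eq (d : ℕ) :
    detA 𝕜 m n ^ d = vanishingIdeal 𝕜 (degreeLT (rightVars m n) d) := by
  rw [← span_X_pow_eq, detA]
  congr 2
  ext f
  simp [rightVars, eq_comm]

lemma mem_detA_pow {d : ℕ} {f : DetS 𝕜 m n} :
    f ∈ detA 𝕜 m n ^ d ↔ ∀ e, rightDegree e < d → coeff e f = 0 := by
  rw [detA_pow_eq]
  exact forall_congr' fun e => by rw [mem_degreeLT_rightVars]

variable {φ : DetR 𝕜 m n →ₐ[𝕜] DetS 𝕜 m n}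

lemma IsDetPhi.map_detx (hφ : IsDetPhi 𝕜 m n φ) (i : Fin m) (j : Fin n) :
    φ (detx 𝕜 m n i j) = monomial (entryMargin (i, j)) 1 := by
  rw [hφ, entryMargin]
  split_ifs
  · rw [X_def, X_def, monomial_mul_monomial, one_mul, add_comm]
  · rw [add_zero, X_def]

lemma IsDetPhi.map_detMonomial (hφ : IsDetPhi 𝕜 m n φ) (E : Fin m × Fin n →₀ ℕ) :
    φ (detMonomial 𝕜 E) = monomial (margin E) 1 := by
  induction E using Finsupp.induction_linear with
  | zero => rw [detMonomial_zero, map_one, map_zero]; rfl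
  | add E F hE hF => rw [detMonomial_add, map_mul, hE, hF, monomial_mul_monomial, map_add, one_mul]
  | single p c =>
    rw [detMonomial_single, map_pow, hφ.map_detx, margin_single]
    induction c with
    | zero => rw [pow_zero, zero_smul]; rfl
    | succ c ih => rw [pow_succ, ih, monomial_mul_monomial, add_smul, one_smul, one_mul]

lemma IsDetPhi.map_mem_vanishingIdeal (hφ : IsDetPhi 𝕜 m n φ) {k : ℕ} {r : DetR 𝕜 m n}
    (hr : r ∈ Ideal.span (Set.range fun p : Fin m × Fin n => detx 𝕜 m n p.1 p.2) ^ k) :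
    φ r ∈ vanishingIdeal 𝕜 (degreeLT (leftVars m n) k) := by
  rw [← span_X_pow_eq]
  suffices Ideal.span (Set.range fun p : Fin m × Fin n => detx 𝕜 m n p.1 p.2) ≤
      (Ideal.span (X '' leftVars m n : Set (DetS 𝕜 m n))).comap φ from
    Ideal.le_comap_pow _ _ (Ideal.pow_right_mono this k hr)
  rw [Ideal.span_le]
  rintro _ ⟨p, rfl⟩
  have hX : X (Sum.inl p.1) ∈ Ideal.span (X '' leftVars m n : Set (DetS 𝕜 m n)) :=
    Ideal.subset_span ⟨_, by simp [leftVars], rfl⟩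
  rw [SetLike.mem_coe, Ideal.mem_comap, hφ]
  split_ifs
  · exact Ideal.mul_mem_left _ _ hX
  · exact hX

lemma mk_mem_span_pow {k : ℕ} {f : DetP 𝕜 m n} (hf : ∀ E, ∑ p, E p < k → coeff E f = 0) :
    Ideal.Quotient.mk (detI2 𝕜 m n) f ∈
      Ideal.span (Set.range fun p : Fin m × Fin n => detx 𝕜 m n p.1 p.2) ^ k := by
  have h : f ∈ vanishingIdeal 𝕜 (degreeLT Finset.univ k) := hf
  rw [← span_X_pow_eq] at h
  replace h := Ideal.mem_map_of_mem (Ideal.Quotient.mk (detI2 𝕜 m n)) h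
  rw [Ideal.map_pow, Ideal.map_span, ← Set.image_comp, Finset.coe_univ, Set.image_univ] at h
  exact h

lemma maximalIdeal_eq_span [IsLocalRing (DetR 𝕜 m n)] (hφ : IsDetPhi 𝕜 m n φ) :
    IsLocalRing.maximalIdeal (DetR 𝕜 m n) =
      Ideal.span (Set.range fun p : Fin m × Fin n => detx 𝕜 m n p.1 p.2) := by
  apply le_antisymm
  · intro r hr
    obtain ⟨f, rfl⟩ := Ideal.Quotient.mk_surjective r
    rw [← pow_one (Ideal.span _)]
    apply mk_mem_span_pow
    intro E hE
    rw [Nat.lt_one_iff, Finset.sum_eq_zero_iff] at hE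
    obtain rfl : E = 0 := by
      ext p
      exact hE p (Finset.mem_univ _)
    by_contra h
    refine hr (IsUnit.map _ (MvPowerSeries.isUnit_iff_constantCoeff.2 (Ne.isUnit h)))
  · rw [Ideal.span_le]
    rintro _ ⟨p, rfl⟩ hu
    have h := MvPowerSeries.isUnit_iff_constantCoeff.1 (hu.map φ)
    have h0 : coeff 0 (φ (detx 𝕜 m n p.1 p.2)) = 0 :=
      hφ.map_mem_vanishingIdeal (k := 1)
        ((pow_one (Ideal.span (Set.range fun p : Fin m × Fin n => detx 𝕜 m n p.1 p.2))).ge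
          (Ideal.subset_span ⟨p, rfl⟩)) 0 (mem_degreeLT_leftVars.2 (by simp))
    exact h.ne_zero h0

/-- The exponents of degree less than `k`. -/
def exponentsLT (m n k : ℕ) : Finset (Fin m × Fin n →₀ ℕ) :=
  ((Finsupp.finite_of_degree_le k).subset (t := {E : Fin m × Fin n →₀ ℕ | ∑ p, E p < k})
    fun E hE => (Finsupp.degree_eq_sum E).trans_le (le_of_lt hE)).toFinset

lemma mem_exponentsLT {k : ℕ} {E : Fin m × Fin n →₀ ℕ} :
    E ∈ exponentsLT m n k ↔ leftDegree (margin E) < k := by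
  rw [exponentsLT, Set.Finite.mem_toFinset, leftDegree_margin]
  rfl

lemma mk_sub_sum_mem (f : DetP 𝕜 m n) (k : ℕ) :
    Ideal.Quotient.mk (detI2 𝕜 m n) f - ∑ E ∈ exponentsLT m n k, coeff E f • detMonomial 𝕜 E ∈
      Ideal.span (Set.range fun p : Fin m × Fin n => detx 𝕜 m n p.1 p.2) ^ k := by
  classical
  have h : ∑ E ∈ exponentsLT m n k, coeff E f • detMonomial 𝕜 E =
      Ideal.Quotient.mk (detI2 𝕜 m n)
        (∑ E ∈ exponentsLT m n k, coeff E f • monomial E (1 : 𝕜)) := by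
    rw [map_sum]
    rfl
  rw [h, ← map_sub]
  apply mk_mem_span_pow
  intro E hE
  rw [map_sub, map_sum, Finset.sum_eq_single_of_mem E]
  · simp
  · rwa [mem_exponentsLT, leftDegree_margin]
  · intro F _ hF
    simp [coeff_monomial, hF.symm]

lemma IsDetPhi.coeff_map_mk (hφ : IsDetPhi 𝕜 m n φ) (f : DetP 𝕜 m n) {k : ℕ}
    {e : Fin m ⊕ Fin (n - 1) →₀ ℕ} (he : leftDegree e < k) :
    coeff e (φ (Ideal.Quotient.mk _ f)) =
      ∑ E ∈ exponentsLT m n k with margin E = e, coeff E f := by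
  classical
  have h := hφ.map_mem_vanishingIdeal (mk_sub_sum_mem f k) e (mem_degreeLT_leftVars.2 he)
  rw [map_sub, map_sub, sub_eq_zero] at h
  rw [h, map_sum, map_sum, Finset.sum_filter]
  refine Finset.sum_congr rfl fun E _ => ?_
  rw [map_smul, hφ.map_detMonomial, coeff_smul, coeff_monomial]
  simp [eq_comm]

lemma IsDetPhi.map_detJ_pow_le (hφ : IsDetPhi 𝕜 m n φ) (d : ℕ) :
    detJ 𝕜 m n ^ d ≤ (detA 𝕜 m n ^ d).comap φ := by
  suffices detJ 𝕜 m n ≤ (detA 𝕜 m n).comap φ from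
    (Ideal.pow_right_mono this d).trans (Ideal.le_comap_pow _ _)
  rw [detJ, Ideal.span_le]
  rintro _ ⟨i, j, hj, rfl⟩
  rw [SetLike.mem_coe, Ideal.mem_comap, hφ, dif_pos hj]
  exact Ideal.mul_mem_right _ _ (Ideal.subset_span ⟨_, rfl⟩)

lemma IsDetPhi.mem_detJ_pow_of_map_mem [IsLocalRing (DetR 𝕜 m n)] (hφ : IsDetPhi 𝕜 m n φ) {d : ℕ}
    {r : DetR 𝕜 m n} (hr : φ r ∈ detA 𝕜 m n ^ d) : r ∈ detJ 𝕜 m n ^ d := by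
  classical
  obtain ⟨f, rfl⟩ := Ideal.Quotient.mk_surjective r
  have h1 (k : ℕ) : ∑ E ∈ exponentsLT m n k, coeff E f • detMonomial 𝕜 E ∈ detJ 𝕜 m n ^ d := by
    rw [← Finset.sum_fiberwise_of_maps_to
      (fun E hE => Finset.mem_image_of_mem (margin : (Fin m × Fin n →₀ ℕ) →+ _) hE)]
    refine sum_mem fun e he => ?_
    obtain ⟨F, hF, rfl⟩ := Finset.mem_image.1 he
    rw [Finset.sum_congr rfl fun E hE => by
      rw [detMonomial_congr (Finset.mem_filter.1 hE).2], ← Finset.sum_smul,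
      ← hφ.coeff_map_mk f (mem_exponentsLT.1 hF)]
    by_cases h : rightDegree (margin F) < d
    · rw [mem_detA_pow.1 hr _ h, zero_smul]
      exact zero_mem _
    · exact Submodule.smul_of_tower_mem _ _
        (Ideal.pow_le_pow_right (not_lt.1 h) (detMonomial_mem_pow F))
  rw [← Ideal.Quotient.eq_zero_iff_mem]
  refine IsHausdorff.haus (I := IsLocalRing.maximalIdeal (DetR 𝕜 m n))
    (M := DetR 𝕜 m n ⧸ detJ 𝕜 m n ^ d) inferInstance _ fun k => ?_
  rw [SModEq.zero, ← sub_zero (Ideal.Quotient.mk (detJ 𝕜 m n ^ d) _),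
    ← Ideal.Quotient.eq_zero_iff_mem.2 (h1 k), ← map_sub]
  have h2 := mk_sub_sum_mem f k
  rw [← maximalIdeal_eq_span hφ] at h2
  have h3 := Submodule.smul_mem_smul h2
    (Submodule.mem_top (x := (1 : DetR 𝕜 m n ⧸ detJ 𝕜 m n ^ d)))
  rw [← mul_one (_ - _ : DetR 𝕜 m n)]
  exact h3

end DeterminantalMap

section DeterminantalModule

variable {𝕜 m n} {φ : DetR 𝕜 m n →ₐ[𝕜] DetS 𝕜 m n}

/-- The exponents not involving the first `k` variables `x_i` and of degree less than `d` in the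
variables `a_j`. -/
def regularExponents (m n k d : ℕ) : LowerSet (Fin m ⊕ Fin (n - 1) →₀ ℕ) where
  carrier := {e | rightDegree e < d ∧ ∀ i : Fin m, (i : ℕ) < k → e (Sum.inl i) = 0}
  lower' := fun a b hab ha => ⟨lt_of_le_of_lt
      (show ∑ j, b (Sum.inr j) ≤ ∑ j, a (Sum.inr j) from Finset.sum_le_sum fun _ _ => hab _) ha.1,
    fun i hi => Nat.eq_zero_of_le_zero ((hab _).trans (ha.2 i hi).le)⟩

lemma mem_regularExponents {k d : ℕ} {e : Fin m ⊕ Fin (n - 1) →₀ ℕ} :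
    e ∈ regularExponents m n k d ↔
      rightDegree e < d ∧ ∀ i : Fin m, (i : ℕ) < k → e (Sum.inl i) = 0 := Iff.rfl

/-- The residue classes of the entries of the last column. -/
def lastColumn (𝕜 : Type) [Field 𝕜] (m : ℕ) {n : ℕ} (l : Fin n) : List (DetR 𝕜 m n) :=
  List.ofFn fun i => detx 𝕜 m n i l

lemma mem_take_lastColumn {l : Fin n} {k : ℕ} {r : DetR 𝕜 m n} :
    r ∈ (lastColumn 𝕜 m l).take k ↔ ∃ i : Fin m, (i : ℕ) < k ∧ detx 𝕜 m n i l = r := by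
  simp only [lastColumn, List.mem_take_iff_getElem, List.length_ofFn, List.getElem_ofFn, lt_min_iff]
  exact ⟨fun ⟨i, ⟨h1, h2⟩, h⟩ => ⟨⟨i, h2⟩, h1, h⟩, fun ⟨i, h1, h⟩ => ⟨i, ⟨h1, i.2⟩, h⟩⟩

lemma IsDetPhi.exists_map_sub_mem_detA_pow (hn : 2 ≤ n) (hφ : IsDetPhi 𝕜 m n φ) {d : ℕ}
    {b : DetS 𝕜 m n} (hb : b ∈ vanishingIdeal 𝕜 (degreeLT (leftVars m n) d)) :
    ∃ r, φ r - b ∈ detA 𝕜 m n ^ d := by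
  classical
  let g : DetP 𝕜 m n := fun E =>
    if Function.invFun (margin : (Fin m × Fin n →₀ ℕ) → _) (margin E) = E then coeff (margin E) b
    else 0
  have hg (E) : coeff E g = if Function.invFun (margin : (Fin m × Fin n →₀ ℕ) → _) (margin E) = E
    then coeff (margin E) b else 0 := rfl
  refine ⟨Ideal.Quotient.mk _ g, mem_detA_pow.2 fun e he => ?_⟩
  rw [map_sub, hφ.coeff_map_mk g (Nat.lt_succ_self _), sub_eq_zero]
  by_cases hd : leftDegree e < d
  · rw [hb e (mem_degreeLT_leftVars.2 hd)]
    refine Finset.sum_eq_zero fun E hE => ?_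
    rw [hg, (Finset.mem_filter.1 hE).2, hb e (mem_degreeLT_leftVars.2 hd), ite_self]
  · have hs := Function.invFun_eq (exists_margin_eq hn e (by omega))
    rw [Finset.sum_eq_single_of_mem (Function.invFun (margin : (Fin m × Fin n →₀ ℕ) → _) e)]
    · rw [hg, hs, if_pos rfl]
    · rw [Finset.mem_filter, mem_exponentsLT, hs]
      exact ⟨Nat.lt_succ_self _, rfl⟩
    · intro E hE hne
      rw [hg, (Finset.mem_filter.1 hE).2, if_neg hne.symm]

variable [Algebra (DetR 𝕜 m n) (DetS 𝕜 m n)]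

lemma mk_mem_ofList_smul_top_iff (hφ : IsDetPhi 𝕜 m n φ)
    (h : ∀ (r : DetR 𝕜 m n) (b : DetS 𝕜 m n), r • b = φ r * b) {l : Fin n}
    (hl : ¬ (l : ℕ) < n - 1) (k d : ℕ) (b : DetS 𝕜 m n) :
    Ideal.Quotient.mk (detA 𝕜 m n ^ d) b ∈ (Ideal.ofList ((lastColumn 𝕜 m l).take k) • ⊤ :
      Submodule (DetR 𝕜 m n) (DetS 𝕜 m n ⧸ detA 𝕜 m n ^ d)) ↔
      b ∈ vanishingIdeal 𝕜 (regularExponents m n k d) := by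
  classical
  have hmk (r : DetR 𝕜 m n) (b : DetS 𝕜 m n) : r • Ideal.Quotient.mk (detA 𝕜 m n ^ d) b =
      Ideal.Quotient.mk (detA 𝕜 m n ^ d) (φ r * b) := by
    rw [← h]
    rfl
  have hx (i : Fin m) : φ (detx 𝕜 m n i l) = X (Sum.inl i) := by rw [hφ, dif_neg hl]
  constructor
  · intro hb
    let P : Submodule (DetR 𝕜 m n) (DetS 𝕜 m n ⧸ detA 𝕜 m n ^ d) :=
      { carrier := {y | ∃ b ∈ vanishingIdeal 𝕜 (regularExponents m n k d),
          Ideal.Quotient.mk _ b = y}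
        zero_mem' := ⟨0, zero_mem _, map_zero _⟩
        add_mem' := by
          rintro _ _ ⟨b, hb, rfl⟩ ⟨c, hc, rfl⟩
          exact ⟨b + c, add_mem hb hc, map_add _ _ _⟩
        smul_mem' := by
          rintro r _ ⟨b, hb, rfl⟩
          exact ⟨φ r * b, Ideal.mul_mem_left _ _ hb, (hmk r b).symm⟩ }
    have hP : Ideal.ofList ((lastColumn 𝕜 m l).take k) • ⊤ ≤ P := by
      rw [Submodule.smul_le]
      intro r hr y _
      induction hr using Submodule.span_induction with
      | mem r hr =>
        obtain ⟨i, hi, rfl⟩ := mem_take_lastColumn.1 hr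
        obtain ⟨c, rfl⟩ := Ideal.Quotient.mk_surjective y
        refine ⟨_, fun e he => ?_, (hmk _ _).symm⟩
        rw [hx, coeff_X_mul_eq, if_pos (he.2 i hi)]
      | zero => exact (zero_smul (DetR 𝕜 m n) y).symm ▸ P.zero_mem
      | add r s _ _ hr hs => rw [add_smul]; exact add_mem hr hs
      | smul c r _ hr => rw [smul_assoc]; exact P.smul_mem c hr
    obtain ⟨c, hc, hcb⟩ := hP hb
    rw [Ideal.Quotient.eq, mem_detA_pow] at hcb
    intro e he
    have := hcb e he.1
    rwa [map_sub, hc e he, zero_sub, neg_eq_zero] at this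
  · intro hb
    let c : DetS 𝕜 m n := fun e => if rightDegree e < d then coeff e b else 0
    have hc (e) : coeff e c = if rightDegree e < d then coeff e b else 0 := rfl
    have hbc : Ideal.Quotient.mk (detA 𝕜 m n ^ d) b = Ideal.Quotient.mk (detA 𝕜 m n ^ d) c := by
      rw [Ideal.Quotient.eq, mem_detA_pow]
      intro e he
      rw [map_sub, hc, if_pos he, sub_self]
    obtain ⟨F, hF, -⟩ := exists_eq_sum_X_mul
      ((Finset.univ.filter fun i : Fin m => (i : ℕ) < k).map Function.Embedding.inl) c
      (fun e he => by
        rw [hc] at he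
        split_ifs at he with hd
        · by_contra! h0
          refine he (hb e ⟨hd, fun i hi => h0 _ ?_⟩)
          simpa using hi
        · exact absurd rfl he)
    rw [hbc, hF, Finset.sum_map, map_sum]
    refine sum_mem fun i hi => ?_
    rw [Function.Embedding.inl_apply, ← hx, ← hmk]
    exact Submodule.smul_mem_smul (Ideal.subset_span
      (mem_take_lastColumn.2 ⟨i, (Finset.mem_filter.1 hi).2, rfl⟩)) Submodule.mem_top

lemma isWeaklyRegular_lastColumn (hφ : IsDetPhi 𝕜 m n φ)
    (h : ∀ (r : DetR 𝕜 m n) (b : DetS 𝕜 m n), r • b = φ r * b) {l : Fin n}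
    (hl : ¬ (l : ℕ) < n - 1) (d : ℕ) :
    RingTheory.Sequence.IsWeaklyRegular (DetS 𝕜 m n ⧸ detA 𝕜 m n ^ d) (lastColumn 𝕜 m l) := by
  rw [RingTheory.Sequence.isWeaklyRegular_iff]
  intro k hk
  have hk' : k < m := by simpa [lastColumn] using hk
  rw [isSMulRegular_quotient_iff_mem_of_smul_mem]
  intro y hy
  obtain ⟨b, rfl⟩ := Ideal.Quotient.mk_surjective y
  have hr : (lastColumn 𝕜 m l)[k] • Ideal.Quotient.mk (detA 𝕜 m n ^ d) b =
      Ideal.Quotient.mk (detA 𝕜 m n ^ d) (X (Sum.inl ⟨k, hk'⟩) * b) := by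
    have := h (lastColumn 𝕜 m l)[k] b
    simp only [lastColumn, List.getElem_ofFn, hφ _ l, dif_neg hl] at this
    simp only [← this, lastColumn, List.getElem_ofFn]
    rfl
  rw [hr, mk_mem_ofList_smul_top_iff hφ h hl] at hy
  rw [mk_mem_ofList_smul_top_iff hφ h hl]
  intro e he
  rw [← coeff_add_single_X_mul (Sum.inl ⟨k, hk'⟩)]
  refine hy _ ⟨?_, fun i hi => ?_⟩
  · rw [map_add, rightDegree_single_inl, add_zero]
    exact he.1
  · rw [Finsupp.add_apply, he.2 i hi, zero_add, Finsupp.single_eq_of_ne]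
    rintro ⟨⟩
    exact hi.false

lemma isPowTorsion_quotient_lastColumn [IsLocalRing (DetR 𝕜 m n)] (hφ : IsDetPhi 𝕜 m n φ)
    (h : ∀ (r : DetR 𝕜 m n) (b : DetS 𝕜 m n), r • b = φ r * b) {l : Fin n}
    (hl : ¬ (l : ℕ) < n - 1) (d : ℕ) :
    localCohomology.IsPowTorsion (IsLocalRing.maximalIdeal (DetR 𝕜 m n))
      ((DetS 𝕜 m n ⧸ detA 𝕜 m n ^ d) ⧸ (Ideal.ofList (lastColumn 𝕜 m l) • ⊤ :
        Submodule (DetR 𝕜 m n) (DetS 𝕜 m n ⧸ detA 𝕜 m n ^ d))) := by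
  intro y
  refine ⟨1, fun r hr => ?_⟩
  obtain ⟨y, rfl⟩ := Submodule.Quotient.mk_surjective _ y
  obtain ⟨b, rfl⟩ := Ideal.Quotient.mk_surjective y
  rw [← Submodule.Quotient.mk_smul, Submodule.Quotient.mk_eq_zero]
  have hr' : r • Ideal.Quotient.mk (detA 𝕜 m n ^ d) b =
      Ideal.Quotient.mk (detA 𝕜 m n ^ d) (φ r * b) := by
    rw [← h]
    rfl
  rw [← List.take_of_length_le (l := lastColumn 𝕜 m l) (i := m) (by simp [lastColumn]), hr',
    mk_mem_ofList_smul_top_iff hφ h hl]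
  rw [maximalIdeal_eq_span hφ] at hr
  intro e he
  refine Ideal.mul_mem_right b _ (hφ.map_mem_vanishingIdeal hr) e (mem_degreeLT_leftVars.2 ?_)
  rw [leftDegree_apply, Finset.sum_eq_zero fun i _ => he.2 i i.2]
  exact zero_lt_one

lemma isPowTorsion_quotient_range [IsLocalRing (DetR 𝕜 m n)] (hn : 2 ≤ n) (hφ : IsDetPhi 𝕜 m n φ)
    (h : ∀ (r : DetR 𝕜 m n) (b : DetS 𝕜 m n), r • b = φ r * b) (d : ℕ) :
    localCohomology.IsPowTorsion (IsLocalRing.maximalIdeal (DetR 𝕜 m n))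
      ((DetS 𝕜 m n ⧸ detA 𝕜 m n ^ d) ⧸ LinearMap.range
        (Algebra.linearMap (DetR 𝕜 m n) (DetS 𝕜 m n ⧸ detA 𝕜 m n ^ d))) := by
  intro y
  refine ⟨d, fun r hr => ?_⟩
  obtain ⟨y, rfl⟩ := Submodule.Quotient.mk_surjective _ y
  obtain ⟨b, rfl⟩ := Ideal.Quotient.mk_surjective y
  rw [← Submodule.Quotient.mk_smul, Submodule.Quotient.mk_eq_zero]
  rw [maximalIdeal_eq_span hφ] at hr
  obtain ⟨s, hs⟩ := hφ.exists_map_sub_mem_detA_pow hn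
    (Ideal.mul_mem_right b _ (hφ.map_mem_vanishingIdeal hr))
  refine ⟨s, ?_⟩
  rw [← Ideal.Quotient.eq, ← mul_one (φ s), ← h, ← h] at hs
  rw [Algebra.linearMap_apply, Algebra.algebraMap_eq_smul_one]
  exact hs

end DeterminantalModule

/-- for every `α ≥ 1`, `H^i_𝔪(R/I^α) = 0` for `i ∉ {1, m}`, and
`H^1_𝔪(R/I^α) ≅ C_α`, the cokernel of `φ^α : R/I^α → S/𝔞^α S` (realized as the quotient of
`S/𝔞^α S` by the range of the structural `R`-linear map `R → S/𝔞^α S`). -/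
theorem statement5 [IsLocalRing (DetR 𝕜 m n)] (hm : 2 ≤ m) (hn : 2 ≤ n)
    (φ : DetR 𝕜 m n →ₐ[𝕜] DetS 𝕜 m n) (hφ : IsDetPhi 𝕜 m n φ) (α : ℕ) (hα : 1 ≤ α) :
    haveI : Algebra (DetR 𝕜 m n) (DetS 𝕜 m n) := φ.toRingHom.toAlgebra
    (∀ i : ℕ, i ≠ 1 → i ≠ m →
      Subsingleton ((localCohomology (IsLocalRing.maximalIdeal (DetR 𝕜 m n)) i).obj
        (ModuleCat.of (DetR 𝕜 m n) (DetR 𝕜 m n ⧸ detJ 𝕜 m n ^ α)))) ∧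
    Nonempty
      (((localCohomology (IsLocalRing.maximalIdeal (DetR 𝕜 m n)) 1).obj
          (ModuleCat.of (DetR 𝕜 m n) (DetR 𝕜 m n ⧸ detJ 𝕜 m n ^ α))) ≃ₗ[DetR 𝕜 m n]
        ((DetS 𝕜 m n ⧸ detA 𝕜 m n ^ α) ⧸
          LinearMap.range
            (Algebra.linearMap (DetR 𝕜 m n) (DetS 𝕜 m n ⧸ detA 𝕜 m n ^ α)))) := by
  let : Algebra (DetR 𝕜 m n) (DetS 𝕜 m n) := φ.toRingHom.toAlgebra
  have h (r : DetR 𝕜 m n) (b : DetS 𝕜 m n) : r • b = φ r * b := rfl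
  have hl : ¬ ((⟨n - 1, by omega⟩ : Fin n) : ℕ) < n - 1 := lt_irrefl _
  have halg (r : DetR 𝕜 m n) : Algebra.linearMap (DetR 𝕜 m n) (DetS 𝕜 m n ⧸ detA 𝕜 m n ^ α) r =
      Ideal.Quotient.mk _ (φ r) := rfl
  let f : (DetR 𝕜 m n ⧸ detJ 𝕜 m n ^ α) →ₗ[DetR 𝕜 m n] (DetS 𝕜 m n ⧸ detA 𝕜 m n ^ α) :=
    Submodule.liftQ (detJ 𝕜 m n ^ α)
      (Algebra.linearMap (DetR 𝕜 m n) (DetS 𝕜 m n ⧸ detA 𝕜 m n ^ α)) fun r hr => by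
        rw [LinearMap.mem_ker, halg, Ideal.Quotient.eq_zero_iff_mem]
        exact hφ.map_detJ_pow_le α hr
  have hf : Function.Injective f := by
    rw [← LinearMap.ker_eq_bot]
    refine Submodule.ker_liftQ_eq_bot _ _ _ fun r hr => ?_
    rw [LinearMap.mem_ker, halg, Ideal.Quotient.eq_zero_iff_mem] at hr
    exact hφ.mem_detJ_pow_of_map_mem hr
  have hrange : LinearMap.range f = LinearMap.range
      (Algebra.linearMap (DetR 𝕜 m n) (DetS 𝕜 m n ⧸ detA 𝕜 m n ^ α)) := Submodule.range_liftQ _ _ _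
  have hN (i : ℕ) (hi : i ≠ m) :
      Subsingleton ((localCohomology (IsLocalRing.maximalIdeal (DetR 𝕜 m n)) i).obj
        (ModuleCat.of (DetR 𝕜 m n) (DetS 𝕜 m n ⧸ detA 𝕜 m n ^ α))) := by
    refine localCohomology.subsingleton_of_isWeaklyRegular _ (lastColumn 𝕜 m ⟨n - 1, by omega⟩)
      (fun r hr => ?_) _ (isWeaklyRegular_lastColumn hφ h hl α)
      (isPowTorsion_quotient_lastColumn hφ h hl α) i (by simpa [lastColumn] using hi)
    obtain ⟨k, rfl⟩ := (List.mem_ofFn' _ _).1 hr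
    rw [maximalIdeal_eq_span hφ]
    exact Ideal.subset_span ⟨(k, _), rfl⟩
  obtain ⟨h1, ⟨e⟩⟩ := localCohomology.of_torsion_coker _ hf
    (hrange ▸ isPowTorsion_quotient_range hn hφ h α) hm hN
  exact ⟨h1, ⟨e.trans (Submodule.quotEquivOfEq _ _ hrange)⟩⟩
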